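/- Let d≥2 and m∈{1,…,d} be integers and let d_1,…,d_m be positive integers with d_1+…+d_m=d. Let X_1,…,X_n be i.i.d. uniform random points in Z_𝕕=B_2^{d_1}×…×B_2^{d_m} and P_n=conv{X_1,…,X_n}. Set d_max=max_i d_i and #d_max=#{i : d_i=d_max}. Then for every j∈{0,…,d−1}, E f_j(P_n) ≍ n^{(d_max−1)/(d_max+1)} (ln n)^{#d_max−1}, with implied constants depending only on (d_1,…,d_m). -/

import Mathlib

open MeasureTheory Filter

noncomputable section

/-- The product body `Z_𝕕 = B_2^{d_1} × ⋯ × B_2^{d_m}`, the product of centered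
Euclidean unit balls, realized in `ℝ^{d_1} × ⋯ × ℝ^{d_m}`. -/
def prodOfBalls {m : ℕ} (dv : Fin m → ℕ) : Set (Π i, EuclideanSpace ℝ (Fin (dv i))) :=
  Set.univ.pi fun i => Metric.closedBall (0 : EuclideanSpace ℝ (Fin (dv i))) 1

/-- The uniform distribution (normalized Lebesgue measure) on a set `K`. -/
def uniformDist {α : Type*} [MeasureSpace α] (K : Set α) : Measure α :=
  (volume K)⁻¹ • volume.restrict K

/-- The number of `j`-dimensional faces of a convex body `K`: faces are the nonempty
convex extreme subsets of `K`, and the dimension of a face is the dimension of its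
affine hull. -/
def faceCount {E : Type*} [AddCommGroup E] [Module ℝ E] (K : Set E) (j : ℕ) : ℕ :=
  Nat.card {F : Set E // F.Nonempty ∧ Convex ℝ F ∧ IsExtreme ℝ K F ∧
    Module.finrank ℝ (vectorSpan ℝ F) = j}

/-- Expected number of `j`-dimensional faces of the convex hull of `n` i.i.d.
uniform random points in `Z_𝕕`. -/
def expectedFaceCountUniform {m : ℕ} (dv : Fin m → ℕ) (j n : ℕ) : ℝ :=
  ∫ x : Fin n → Π i, EuclideanSpace ℝ (Fin (dv i)),
    (faceCount (convexHull ℝ (Set.range x)) j : ℝ)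
    ∂(Measure.pi fun _ : Fin n => uniformDist (prodOfBalls dv))

theorem volume_closedBall_one_ne_zero (k : ℕ) :
    volume (Metric.closedBall (0 : EuclideanSpace ℝ (Fin k)) 1) ≠ 0 :=
  (Metric.measure_closedBall_pos _ _ one_pos).ne'

theorem volume_closedBall_one_ne_top (k : ℕ) :
    volume (Metric.closedBall (0 : EuclideanSpace ℝ (Fin k)) 1) ≠ ⊤ :=
  (isCompact_closedBall _ _).measure_lt_top.ne

/-- The uniform distribution on the Euclidean unit ball. -/
abbrev ballDist (k : ℕ) : Measure (EuclideanSpace ℝ (Fin k)) :=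
  uniformDist (Metric.closedBall (0 : EuclideanSpace ℝ (Fin k)) 1)

instance isProbabilityMeasure_ballDist (k : ℕ) : IsProbabilityMeasure (ballDist k) := by
  constructor
  simp [ballDist, uniformDist, ENNReal.inv_mul_cancel (volume_closedBall_one_ne_zero k)
    (volume_closedBall_one_ne_top k)]

section

open scoped InnerProductSpace RealInnerProductSpace

/-- The linear map stretching the direction `u` by `s ^ 2` and its orthogonal complement by `s`. -/
def parabolicScaling {k : ℕ} (u : EuclideanSpace ℝ (Fin k)) (s : ℝ) :
    EuclideanSpace ℝ (Fin k) →ₗ[ℝ] EuclideanSpace ℝ (Fin k) :=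
  s • LinearMap.transvection ((s - 1) • (innerₗ (EuclideanSpace ℝ (Fin k)) u)) u

theorem parabolicScaling_apply {k : ℕ} (u : EuclideanSpace ℝ (Fin k)) (s : ℝ)
    (w : EuclideanSpace ℝ (Fin k)) :
    parabolicScaling u s w = s • (w + ((s - 1) * ⟪u, w⟫) • u) := by
  simp [parabolicScaling, LinearMap.transvection.apply]

theorem det_parabolicScaling {k : ℕ} {u : EuclideanSpace ℝ (Fin k)} (hu : ‖u‖ = 1) (s : ℝ) :
    (parabolicScaling u s).det = s ^ (k + 1) := by
  simp [parabolicScaling, LinearMap.det_smul, LinearMap.transvection.det, hu, pow_succ]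

theorem volume_preimage_parabolicScaling {k : ℕ} {u : EuclideanSpace ℝ (Fin k)} (hu : ‖u‖ = 1)
    {s r : ℝ} (hs : 0 < s) (hr : 0 ≤ r) (x : EuclideanSpace ℝ (Fin k)) :
    volume ((fun y => u - y) ⁻¹' (parabolicScaling u s '' Metric.closedBall x r)) =
      ENNReal.ofReal (s ^ (k + 1) * r ^ k) *
        volume (Metric.closedBall (0 : EuclideanSpace ℝ (Fin k)) 1) := by
  have h1 : volume ((fun y => u - y) ⁻¹' (parabolicScaling u s '' Metric.closedBall x r)) =
      volume (parabolicScaling u s '' Metric.closedBall x r) := by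
    have h2 := (Measure.measurePreserving_sub_left
      (volume : Measure (EuclideanSpace ℝ (Fin k))) u)
    exact h2.measure_preimage_equiv (f := MeasurableEquiv.subLeft u) _
  rw [h1, Measure.addHaar_image_linearMap, det_parabolicScaling hu,
    Measure.addHaar_closedBall' _ _ hr, ← mul_assoc, ← ENNReal.ofReal_mul (abs_nonneg _)]
  simp [abs_of_pos hs]

theorem rpow_half_eq {h : ℝ} (hh : 0 < h) (k : ℕ) :
    √h ^ (k + 1) = h ^ (((k : ℝ) + 1) / 2) := by
  rw [Real.sqrt_eq_rpow, ← Real.rpow_natCast, ← Real.rpow_mul hh.le]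
  congr 1
  push_cast
  ring

theorem ballDist_apply_of_volume_le {k : ℕ} {S : Set (EuclideanSpace ℝ (Fin k))} {c : ENNReal}
    (h : volume (S ∩ Metric.closedBall 0 1) ≤
      c * volume (Metric.closedBall (0 : EuclideanSpace ℝ (Fin k)) 1)) :
    ballDist k S ≤ c := by
  rw [ballDist, uniformDist, Measure.smul_apply, smul_eq_mul,
    Measure.restrict_apply' Metric.isClosed_closedBall.measurableSet]
  calc _ ≤ (volume (Metric.closedBall (0 : EuclideanSpace ℝ (Fin k)) 1))⁻¹ *
      (c * volume (Metric.closedBall (0 : EuclideanSpace ℝ (Fin k)) 1)) := by gcongr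
    _ = c * ((volume (Metric.closedBall (0 : EuclideanSpace ℝ (Fin k)) 1))⁻¹ *
          volume (Metric.closedBall (0 : EuclideanSpace ℝ (Fin k)) 1)) := by ring
    _ = c := by
      rw [ENNReal.inv_mul_cancel (volume_closedBall_one_ne_zero k)
        (volume_closedBall_one_ne_top k), mul_one]

theorem le_ballDist_apply_of_le_volume {k : ℕ} {S : Set (EuclideanSpace ℝ (Fin k))} {c : ENNReal}
    (h : c * volume (Metric.closedBall (0 : EuclideanSpace ℝ (Fin k)) 1) ≤
      volume (S ∩ Metric.closedBall 0 1)) :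
    c ≤ ballDist k S := by
  rw [ballDist, uniformDist, Measure.smul_apply, smul_eq_mul,
    Measure.restrict_apply' Metric.isClosed_closedBall.measurableSet]
  calc c = c * ((volume (Metric.closedBall (0 : EuclideanSpace ℝ (Fin k)) 1))⁻¹ *
          volume (Metric.closedBall (0 : EuclideanSpace ℝ (Fin k)) 1)) := by
        rw [ENNReal.inv_mul_cancel (volume_closedBall_one_ne_zero k)
          (volume_closedBall_one_ne_top k), mul_one]
    _ = (volume (Metric.closedBall (0 : EuclideanSpace ℝ (Fin k)) 1))⁻¹ *
      (c * volume (Metric.closedBall (0 : EuclideanSpace ℝ (Fin k)) 1)) := by ring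
    _ ≤ _ := by gcongr

theorem ballDist_cap_le_of_unit {k : ℕ} {u : EuclideanSpace ℝ (Fin k)} (hu : ‖u‖ = 1)
    {h : ℝ} (hh : 0 < h) :
    ballDist k {y | 1 - ⟪y, u⟫ ≤ h} ≤ ENNReal.ofReal (2 ^ k * h ^ (((k : ℝ) + 1) / 2)) := by
  apply ballDist_apply_of_volume_le
  have hs : 0 < √h := Real.sqrt_pos.2 hh
  have hs2 : √h ^ 2 = h := Real.sq_sqrt hh.le
  rw [← rpow_half_eq hh, mul_comm (2 ^ k : ℝ),
    ← volume_preimage_parabolicScaling hu hs (by norm_num : (0 : ℝ) ≤ 2) 0]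
  apply measure_mono
  rintro y ⟨hy1, hy2⟩
  simp only [Set.mem_ofPred_eq] at hy1
  rw [mem_closedBall_zero_iff] at hy2
  have hyu : ⟪y, u⟫ ≤ 1 := by
    have := real_inner_le_norm y u
    rw [hu, mul_one] at this; linarith
  set z := u - y with hz
  have hzu : ⟪u, z⟫ = 1 - ⟪y, u⟫ := by
    rw [hz, inner_sub_right, real_inner_self_eq_norm_sq, hu, real_inner_comm]; ring
  have hzn : ‖z‖ ^ 2 ≤ 2 * ⟪u, z⟫ := by
    rw [hzu, hz, norm_sub_sq_real, hu, real_inner_comm]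
    nlinarith [norm_nonneg y]
  set c := ⟪u, z⟫ with hc
  set s := √h with hsd
  refine ⟨s⁻¹ • (z + ((s⁻¹ - 1) * c) • u), ?_, ?_⟩
  · rw [mem_closedBall_zero_iff]
    have h1 : ‖s⁻¹ • (z + ((s⁻¹ - 1) * c) • u)‖ ^ 2 = h⁻¹ * (‖z‖ ^ 2 + (h⁻¹ - 1) * c ^ 2) := by
      rw [norm_smul, mul_pow, norm_add_sq_real, norm_smul, inner_smul_right, hu,
        real_inner_comm, ← hc, ← hs2]
      simp only [norm_inv, Real.norm_eq_abs, mul_pow, sq_abs, inv_pow, mul_one]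
      ring
    have h2 : h⁻¹ * (‖z‖ ^ 2 + (h⁻¹ - 1) * c ^ 2) ≤ 4 := by
      have hc0 : 0 ≤ c := by rw [hzu]; linarith
      have hch : c ≤ h := by rw [hzu]; linarith
      have hch' : h⁻¹ * c ≤ 1 := by
        rw [inv_mul_le_iff₀ hh]; linarith
      have h0 : 0 < h⁻¹ := inv_pos.2 hh
      have h3 : h⁻¹ * (‖z‖ ^ 2 + (h⁻¹ - 1) * c ^ 2) ≤ h⁻¹ * (2 * c + h⁻¹ * c ^ 2) := by
        gcongr ?_ * (?_ + ?_)
        nlinarith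
      have h4 : h⁻¹ * (2 * c + h⁻¹ * c ^ 2) = 2 * (h⁻¹ * c) + (h⁻¹ * c) ^ 2 := by ring
      have h5 : 0 ≤ h⁻¹ * c := by positivity
      nlinarith
    rw [← h1] at h2
    nlinarith [norm_nonneg (s⁻¹ • (z + ((s⁻¹ - 1) * c) • u))]
  · rw [parabolicScaling_apply]
    simp only [inner_smul_right, inner_add_right, real_inner_self_eq_norm_sq, hu, ← hc]
    rw [smul_add, smul_smul, smul_smul, mul_inv_cancel₀ hs.ne', one_smul, add_assoc, ← add_smul]
    convert add_zero z
    convert zero_smul ℝ u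
    field_simp
    ring

theorem ballDist_cap_le {k : ℕ} {p : EuclideanSpace ℝ (Fin k)} (hp : ‖p‖ ≤ 1)
    {h : ℝ} (hh : 0 < h) :
    ballDist k {y | 1 - ⟪y, p⟫ ≤ h} ≤ ENNReal.ofReal (2 ^ k * h ^ (((k : ℝ) + 1) / 2)) := by
  rcases le_or_gt 1 h with h1 | h1
  · refine prob_le_one.trans ?_
    rw [ENNReal.one_le_ofReal]
    have := Real.one_le_rpow h1 (by positivity : 0 ≤ ((k : ℝ) + 1) / 2)
    have := one_le_pow₀ (by norm_num : (1 : ℝ) ≤ 2) (n := k)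
    nlinarith
  · rcases eq_or_ne p 0 with rfl | hp0
    · have : {y : EuclideanSpace ℝ (Fin k) | 1 - ⟪y, (0 : EuclideanSpace ℝ (Fin k))⟫ ≤ h} = ∅ := by
        ext y; simp [h1]
      rw [this]; simp
    · have hpn : 0 < ‖p‖ := norm_pos_iff.2 hp0
      refine le_trans (measure_mono ?_)
        (ballDist_cap_le_of_unit (u := ‖p‖⁻¹ • p) (norm_smul_inv_norm hp0) hh)
      intro y hy
      simp only [Set.mem_ofPred_eq] at hy ⊢
      rw [inner_smul_right]
      have h2 : 1 ≤ ‖p‖⁻¹ := (one_le_inv₀ hpn).2 hp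
      nlinarith

theorem le_ballDist_cap {k : ℕ} {u : EuclideanSpace ℝ (Fin k)} (hu : ‖u‖ = 1)
    {h : ℝ} (hh : 0 < h) (hh2 : h ≤ 2) :
    ENNReal.ofReal ((1 / 4) ^ k * h ^ (((k : ℝ) + 1) / 2)) ≤ ballDist k {y | 1 - ⟪y, u⟫ ≤ h} := by
  apply le_ballDist_apply_of_le_volume
  have hs : 0 < √h := Real.sqrt_pos.2 hh
  have hs2 : √h ^ 2 = h := Real.sq_sqrt hh.le
  rw [← rpow_half_eq hh, mul_comm ((1 / 4) ^ k : ℝ),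
    ← volume_preimage_parabolicScaling hu hs (by norm_num : (0 : ℝ) ≤ 1 / 4) ((1 / 2 : ℝ) • u)]
  apply measure_mono
  rintro y ⟨w, hw, hwy⟩
  rw [mem_closedBall_iff_norm] at hw
  have hw2 : ‖w - (1 / 2 : ℝ) • u‖ ^ 2 ≤ 1 / 16 := by
    nlinarith [norm_nonneg (w - (1 / 2 : ℝ) • u)]
  set c := ⟪u, w⟫ with hc
  have hc2 : |c - 1 / 2| ≤ 1 / 4 := by
    have h1 : c - 1 / 2 = ⟪u, w - (1 / 2 : ℝ) • u⟫ := by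
      rw [inner_sub_right, inner_smul_right, real_inner_self_eq_norm_sq, hu]; ring
    rw [h1]
    refine (abs_real_inner_le_norm _ _).trans ?_
    rw [hu, one_mul]; exact hw
  rw [abs_le] at hc2
  have hwn : ‖w‖ ^ 2 ≤ c + 1 / 16 - 1 / 4 := by
    rw [norm_sub_sq_real, inner_smul_right, norm_smul, hu, real_inner_comm, ← hc] at hw2
    norm_num at hw2 ⊢
    linarith
  rw [parabolicScaling_apply] at hwy
  set s := √h with hsd
  have hy : y = u - s • (w + ((s - 1) * c) • u) := by rw [hwy]; exact (sub_sub_cancel u y).symm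
  have huy : ⟪y, u⟫ = 1 - h * c := by
    rw [hy, inner_sub_left, real_inner_self_eq_norm_sq, hu, inner_smul_left, inner_add_left,
      inner_smul_left, real_inner_self_eq_norm_sq, hu, real_inner_comm, ← hc, ← hs2]
    simp
    ring
  have hyn : ‖y‖ ^ 2 = 1 - 2 * h * c + h * (‖w‖ ^ 2 + (h - 1) * c ^ 2) := by
    rw [hy, norm_sub_sq_real, hu, inner_smul_right, inner_add_right, inner_smul_right,
      real_inner_self_eq_norm_sq, hu, norm_smul, mul_pow, norm_add_sq_real, inner_smul_right,
      norm_smul, hu, real_inner_comm u w, ← hc, ← hs2]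
    simp only [Real.norm_eq_abs, mul_pow, sq_abs]
    ring
  constructor
  · simp only [Set.mem_ofPred_eq, huy]
    nlinarith
  · rw [mem_closedBall_zero_iff]
    have : ‖y‖ ^ 2 ≤ 1 := by
      rw [hyn]
      have h3 : ‖w‖ ^ 2 + (h - 1) * c ^ 2 ≤ 2 * c := by nlinarith
      nlinarith
    nlinarith [norm_nonneg y]

theorem ballDist_closedBall {k : ℕ} {r : ℝ} (hr : 0 ≤ r) (hr1 : r ≤ 1) :
    ballDist k (Metric.closedBall 0 r) = ENNReal.ofReal (r ^ k) := by
  rw [ballDist, uniformDist, Measure.smul_apply, smul_eq_mul,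
    Measure.restrict_apply' Metric.isClosed_closedBall.measurableSet,
    Set.inter_eq_left.2 (Metric.closedBall_subset_closedBall hr1),
    Measure.addHaar_closedBall' _ _ hr, mul_comm, mul_assoc,
    ENNReal.mul_inv_cancel (volume_closedBall_one_ne_zero k) (volume_closedBall_one_ne_top k)]
  simp

theorem ballDist_norm_le {k : ℕ} {r : ℝ} (hr : 0 ≤ r) (hr1 : r ≤ 1) :
    (ballDist k).real {y | ‖y‖ ≤ r} = r ^ k := by
  have : {y : EuclideanSpace ℝ (Fin k) | ‖y‖ ≤ r} = Metric.closedBall 0 r := by ext; simp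
  rw [measureReal_def, this, ballDist_closedBall hr hr1, ENNReal.toReal_ofReal (by positivity)]

theorem ae_norm_le_one_ballDist (k : ℕ) : ∀ᵐ y ∂(ballDist k), ‖y‖ ≤ 1 := by
  have h : ballDist k {y | ‖y‖ ≤ 1} = 1 := by
    have : {y : EuclideanSpace ℝ (Fin k) | ‖y‖ ≤ 1} = Metric.closedBall 0 1 := by ext; simp
    rw [this, ballDist_closedBall zero_le_one le_rfl]; simp
  exact (mem_ae_iff_prob_eq_one (measurableSet_le measurable_norm measurable_const)).2 h

end

section

open Module

section Polytope

variable {ι V : Type*} [AddCommGroup V] [Module ℝ V]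

/-- The points indexed by `I` lie on the boundary of a closed half-space containing all points
`x i`. Affine functionals on `V` are represented by linear functionals on `V × ℝ`. -/
def Supports (x : ι → V) (I : Finset ι) : Prop :=
  ∃ f : Dual ℝ (V × ℝ), f ≠ 0 ∧ (∀ i, 0 ≤ f (x i, 1)) ∧ ∀ i ∈ I, f (x i, 1) = 0

/-- All subfamilies of size at most `dim V + 1` are affinely independent. -/
def GenPos (x : ι → V) : Prop :=
  ∀ s : Finset ι, s.card ≤ finrank ℝ V + 1 → AffineIndependent ℝ (fun i : s => x i)

theorem Supports.mono {x : ι → V} {I J : Finset ι} (h : Supports x J) (hIJ : I ⊆ J) :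
    Supports x I :=
  let ⟨f, h0, h1, h2⟩ := h
  ⟨f, h0, h1, fun i hi => h2 i (hIJ hi)⟩

theorem AffineIndependent.linearIndependent_lift {p : ι → V} (hp : AffineIndependent ℝ p) :
    LinearIndependent ℝ (fun i => (p i, (1 : ℝ))) := by
  rw [linearIndependent_iff']
  intro s g hg
  have h1 := congrArg Prod.fst hg
  have h2 := congrArg Prod.snd hg
  simp only [Prod.fst_sum, Prod.snd_sum, Prod.smul_fst, Prod.smul_snd, smul_eq_mul, mul_one,
    Prod.fst_zero, Prod.snd_zero] at h1 h2
  exact affineIndependent_iff.1 hp s g h2 h1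

variable [FiniteDimensional ℝ V]

theorem GenPos.card_zeros_le [Fintype ι] {x : ι → V} (hx : GenPos x) {f : Dual ℝ (V × ℝ)}
    (hf : f ≠ 0) {s : Finset ι} (hs : ∀ i ∈ s, f (x i, 1) = 0) : s.card ≤ finrank ℝ V := by
  by_contra! hlt
  obtain ⟨t, hts, htc⟩ := Finset.exists_subset_card_eq (Nat.succ_le_of_lt hlt)
  have hli := (hx t (by omega)).linearIndependent_lift
  have htop := hli.span_eq_top_of_card_eq_finrank' (by simp [htc])
  apply hf
  apply LinearMap.ext_on_range (v := fun i : t => (x i, (1 : ℝ))) htop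
  intro i
  simpa using hs i (hts i.2)

theorem exists_dual_vanishing_notMem_span [Fintype ι] (x : ι → V) (s : Finset ι)
    (hs : s.card < finrank ℝ V) (f : Dual ℝ (V × ℝ)) :
    ∃ g : Dual ℝ (V × ℝ), (∀ i ∈ s, g (x i, 1) = 0) ∧ ∀ r : ℝ, g ≠ r • f := by
  let Φ : Dual ℝ (V × ℝ) →ₗ[ℝ] (s → ℝ) :=
    LinearMap.pi fun i => Dual.eval ℝ (V × ℝ) (x i, 1)
  have h1 := Φ.finrank_range_add_finrank_ker
  have h2 : finrank ℝ (LinearMap.range Φ) ≤ s.card := by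
    refine (Submodule.finrank_le _).trans ?_
    simp
  have h3 : finrank ℝ (Dual ℝ (V × ℝ)) = finrank ℝ V + 1 := by
    rw [Subspace.dual_finrank_eq]; simp
  have h4 : ¬ (LinearMap.ker Φ ≤ Submodule.span ℝ {f}) := by
    intro hle
    have h5 := Submodule.finrank_mono hle
    have h6 := finrank_span_le_card (R := ℝ) ({f} : Set (Dual ℝ (V × ℝ)))
    simp at h6
    omega
  obtain ⟨g, hg, hgf⟩ := SetLike.not_le_iff_exists.1 h4
  refine ⟨g, fun i hi => ?_, fun r hr => hgf ?_⟩
  · have := congrFun (LinearMap.mem_ker.1 hg) ⟨i, hi⟩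
    simpa [Φ] using this
  · rw [hr]
    exact Submodule.smul_mem _ _ (Submodule.mem_span_singleton_self f)

theorem Supports.exists_ssuperset [Fintype ι] [DecidableEq ι] {x : ι → V} {s : Finset ι}
    (hsup : Supports x s) (hs : s.card < finrank ℝ V)
    (hι : finrank ℝ V ≤ Fintype.card ι) : ∃ k, k ∉ s ∧ Supports x (insert k s) := by
  obtain ⟨f, hf0, hfn, hfs⟩ := hsup
  by_cases hz : ∃ k, k ∉ s ∧ f (x k, 1) = 0
  · obtain ⟨k, hk, hk0⟩ := hz
    refine ⟨k, hk, f, hf0, hfn, ?_⟩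
    intro i hi
    rcases Finset.mem_insert.1 hi with rfl | hi
    exacts [hk0, hfs i hi]
  push Not at hz
  have hpos : ∀ k, k ∉ s → 0 < f (x k, 1) := fun k hk => lt_of_le_of_ne (hfn k) (hz k hk).symm
  obtain ⟨g, hgs, hgf⟩ := exists_dual_vanishing_notMem_span x s hs f
  have hne : (sᶜ).Nonempty := by
    rw [← Finset.card_pos, Finset.card_compl]; omega
  obtain ⟨k, hk, hmax⟩ := Finset.exists_max_image sᶜ (fun i => g (x i, 1) / f (x i, 1)) hne
  rw [Finset.mem_compl] at hk
  refine ⟨k, hk, (g (x k, 1) / f (x k, 1)) • f - g, ?_, ?_, ?_⟩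
  · intro h
    exact hgf _ (sub_eq_zero.1 h).symm
  · intro i
    by_cases hi : i ∈ s
    · simp [hfs i hi, hgs i hi]
    · have h1 := hmax i (Finset.mem_compl.2 hi)
      rw [div_le_iff₀ (hpos i hi)] at h1
      simpa using h1
  · intro i hi
    rcases Finset.mem_insert.1 hi with rfl | hi
    · simp [div_mul_cancel₀ _ (hpos _ hk).ne']
    · simp [hfs i hi, hgs i hi]

theorem Supports.exists_superset_card_eq [Fintype ι] [DecidableEq ι] {x : ι → V} {s : Finset ι}
    (hsup : Supports x s) (hι : finrank ℝ V ≤ Fintype.card ι) {c : ℕ} (hsc : s.card ≤ c)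
    (hc : c ≤ finrank ℝ V) : ∃ t, s ⊆ t ∧ t.card = c ∧ Supports x t := by
  induction c, hsc using Nat.le_induction with
  | base => exact ⟨s, subset_rfl, rfl, hsup⟩
  | succ c hsc ih =>
    obtain ⟨t, hst, htc, ht⟩ := ih (by omega)
    obtain ⟨k, hk, hks⟩ := ht.exists_ssuperset (by omega) hι
    exact ⟨insert k t, hst.trans (Finset.subset_insert k t), by
      rw [Finset.card_insert_of_notMem hk, htc], hks⟩

theorem LinearIndependent.exists_dual_eq {W κ : Type*} [AddCommGroup W] [Module ℝ W]
    {v : κ → W} (hv : LinearIndependent ℝ v) (c : κ → ℝ) :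
    ∃ g : Dual ℝ W, ∀ i, g (v i) = c i := by
  obtain ⟨g, hg⟩ := LinearMap.exists_extend ((Finsupp.linearCombination ℝ c).comp hv.repr)
  refine ⟨g, fun i => ?_⟩
  have := LinearMap.congr_fun hg ⟨v i, Submodule.subset_span (Set.mem_range_self i)⟩
  simp only [LinearMap.coe_comp, Function.comp_apply, Submodule.coe_subtype] at this
  rw [this, hv.repr_eq_single i _ rfl]
  simp

theorem GenPos.exists_exact [Fintype ι] [DecidableEq ι] {x : ι → V} (hx : GenPos x)
    {s : Finset ι} (hsup : Supports x s) :
    ∃ f : Dual ℝ (V × ℝ), (∀ i ∈ s, f (x i, 1) = 0) ∧ ∀ i, i ∉ s → 0 < f (x i, 1) := by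
  obtain ⟨f, hf0, hfn, hfs⟩ := hsup
  let Z : Finset ι := Finset.univ.filter fun i => f (x i, 1) = 0
  have hZ : Z.card ≤ finrank ℝ V := hx.card_zeros_le hf0 (by simp [Z])
  obtain ⟨g, hg⟩ := (hx Z (by omega)).linearIndependent_lift.exists_dual_eq
    (fun i => if (i : ι) ∈ s then 0 else 1)
  have hgZ : ∀ i, f (x i, 1) = 0 → g (x i, 1) = if i ∈ s then 0 else 1 :=
    fun i hi => hg ⟨i, by simp [Z, hi]⟩
  let M : ℝ := ∑ i, |g (x i, 1)| / f (x i, 1) + 1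
  refine ⟨M • f + g, fun i hi => ?_, fun i hi => ?_⟩
  · simp [hfs i hi, hgZ i (hfs i hi), hi]
  · rcases (hfn i).eq_or_lt with h0 | hpos
    · simp [← h0, hgZ i h0.symm, hi]
    · have h1 : |g (x i, 1)| / f (x i, 1) ≤ ∑ i, |g (x i, 1)| / f (x i, 1) :=
        Finset.single_le_sum (f := fun i => |g (x i, 1)| / f (x i, 1))
          (fun j _ => div_nonneg (abs_nonneg _) (hfn j)) (Finset.mem_univ i)
      have h2 : |g (x i, 1)| / f (x i, 1) < M := by simp only [M]; linarith
      rw [div_lt_iff₀ hpos] at h2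
      simp only [LinearMap.add_apply, LinearMap.smul_apply, smul_eq_mul]
      linarith [neg_abs_le (g (x i, 1))]

omit [FiniteDimensional ℝ V] in
theorem mem_convexHull_range_iff_exists_weights [Fintype ι] {x : ι → V} {y : V} :
    y ∈ convexHull ℝ (Set.range x) ↔
      ∃ w : ι → ℝ, (∀ i, 0 ≤ w i) ∧ ∑ i, w i = 1 ∧ ∑ i, w i • x i = y := by
  classical
  constructor
  · intro hy
    have hconv : Convex ℝ ((Fintype.linearCombination ℝ x) '' stdSimplex ℝ ι) :=
      (convex_stdSimplex ℝ ι).linear_image _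
    have hsub : Set.range x ⊆ (Fintype.linearCombination ℝ x) '' stdSimplex ℝ ι := by
      rintro _ ⟨i, rfl⟩
      exact ⟨Pi.single i 1, single_mem_stdSimplex ℝ i, by simp⟩
    obtain ⟨w, hw, hwy⟩ := convexHull_min hsub hconv hy
    exact ⟨w, hw.1, hw.2, by simpa [Fintype.linearCombination_apply] using hwy⟩
  · rintro ⟨w, hw0, hw1, rfl⟩
    exact mem_convexHull_of_exists_fintype w x hw0 hw1 (fun i => Set.mem_range_self i) rfl

omit [FiniteDimensional ℝ V] in
theorem dual_lift_sum [Fintype ι] (f : Dual ℝ (V × ℝ)) (x : ι → V) {w : ι → ℝ}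
    (hw : ∑ i, w i = 1) : f (∑ i, w i • x i, 1) = ∑ i, w i * f (x i, 1) := by
  have : (∑ i, w i • x i, (1 : ℝ)) = ∑ i, w i • (x i, (1 : ℝ)) := by
    ext
    · simp [Prod.fst_sum]
    · simp [Prod.snd_sum, hw]
  simp only [this, map_sum, map_smul, smul_eq_mul]

omit [FiniteDimensional ℝ V] in
theorem dual_lift_nonneg [Fintype ι] {f : Dual ℝ (V × ℝ)} {x : ι → V}
    (hf : ∀ i, 0 ≤ f (x i, 1)) {y : V} (hy : y ∈ convexHull ℝ (Set.range x)) : 0 ≤ f (y, 1) := by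
  obtain ⟨w, hw0, hw1, rfl⟩ := mem_convexHull_range_iff_exists_weights.1 hy
  rw [dual_lift_sum f x hw1]
  exact Finset.sum_nonneg fun i _ => mul_nonneg (hw0 i) (hf i)

omit [FiniteDimensional ℝ V] in
theorem mem_convexHull_image_of_weights [Fintype ι] {x : ι → V} {s : Finset ι} {w : ι → ℝ}
    (hw0 : ∀ i, 0 ≤ w i) (hw1 : ∑ i, w i = 1) (hws : ∀ i, i ∉ s → w i = 0) :
    ∑ i, w i • x i ∈ convexHull ℝ (x '' s) := by
  have h1 : ∑ i ∈ s, w i • x i = ∑ i, w i • x i :=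
    Finset.sum_subset (Finset.subset_univ s) fun i _ hi => by simp [hws i hi]
  have h2 : ∑ i ∈ s, w i = 1 := by
    rw [← hw1]
    exact Finset.sum_subset (Finset.subset_univ s) fun i _ hi => hws i hi
  rw [← h1]
  exact (convex_convexHull ℝ _).sum_mem (fun i _ => hw0 i) h2
    fun i hi => subset_convexHull ℝ _ ⟨i, hi, rfl⟩

omit [FiniteDimensional ℝ V] in
theorem mem_convexHull_image_of_dual_eq_zero [Fintype ι] {f : Dual ℝ (V × ℝ)} {x : ι → V}
    {s : Finset ι} (hf : ∀ i, 0 ≤ f (x i, 1)) (hfs : ∀ i, i ∉ s → 0 < f (x i, 1))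
    {y : V} (hy : y ∈ convexHull ℝ (Set.range x)) (hy0 : f (y, 1) = 0) :
    y ∈ convexHull ℝ (x '' s) := by
  obtain ⟨w, hw0, hw1, rfl⟩ := mem_convexHull_range_iff_exists_weights.1 hy
  rw [dual_lift_sum f x hw1,
    Finset.sum_eq_zero_iff_of_nonneg fun i _ => mul_nonneg (hw0 i) (hf i)] at hy0
  exact mem_convexHull_image_of_weights hw0 hw1 fun i hi =>
    (mul_eq_zero.1 (hy0 i (Finset.mem_univ i))).resolve_right (hfs i hi).ne'

omit [FiniteDimensional ℝ V] in
theorem dual_lift_eq_zero_of_mem_convexHull {f : Dual ℝ (V × ℝ)} {x : ι → V} {s : Finset ι}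
    (hf : ∀ i ∈ s, f (x i, 1) = 0) {y : V} (hy : y ∈ convexHull ℝ (x '' s)) : f (y, 1) = 0 := by
  have hconv : Convex ℝ {y : V | f (y, 1) = 0} := by
    intro a ha b hb t r _ _ htr
    rw [Set.mem_ofPred_eq] at ha hb ⊢
    have : (t • a + r • b, (1 : ℝ)) = t • (a, (1 : ℝ)) + r • (b, (1 : ℝ)) := by
      ext <;> simp [htr]
    rw [this, map_add, map_smul, map_smul, ha, hb]; simp
  refine convexHull_min ?_ hconv hy
  rintro _ ⟨i, hi, rfl⟩
  exact hf i hi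

omit [FiniteDimensional ℝ V] in
theorem isExtreme_convexHull_image [Fintype ι] {f : Dual ℝ (V × ℝ)} {x : ι → V} {s : Finset ι}
    (hf : ∀ i ∈ s, f (x i, 1) = 0) (hfs : ∀ i, i ∉ s → 0 < f (x i, 1)) :
    IsExtreme ℝ (convexHull ℝ (Set.range x)) (convexHull ℝ (x '' s)) := by
  have hfn : ∀ i, 0 ≤ f (x i, 1) := fun i => by
    by_cases hi : i ∈ s
    exacts [(hf i hi).ge, (hfs i hi).le]
  refine ⟨convexHull_mono (Set.image_subset_range x s), fun a ha b hb z hz hzab => ?_⟩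
  obtain ⟨t, r, ht, hr, htr, rfl⟩ := hzab
  have h0 := dual_lift_eq_zero_of_mem_convexHull hf hz
  have : (t • a + r • b, (1 : ℝ)) = t • (a, (1 : ℝ)) + r • (b, (1 : ℝ)) := by
    ext <;> simp [htr]
  rw [this, map_add, map_smul, map_smul, smul_eq_mul, smul_eq_mul] at h0
  have h1 := dual_lift_nonneg hfn ha
  have h2 := dual_lift_nonneg hfn hb
  refine mem_convexHull_image_of_dual_eq_zero hfn hfs ha ?_
  have h3 : 0 ≤ t * f (a, 1) := by positivity
  have h4 : 0 ≤ r * f (b, 1) := by positivity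
  have h5 : t * f (a, 1) = 0 := by linarith
  exact (mul_eq_zero.1 h5).resolve_left ht.ne'

end Polytope

end

section

open Module

section Faces

variable {ι V : Type*} [NormedAddCommGroup V] [NormedSpace ℝ V]

theorem IsExtreme.convexHull_eq [Fintype ι] {x : ι → V} {F : Set V} (hc : Convex ℝ F)
    (hF : IsExtreme ℝ (convexHull ℝ (Set.range x)) F) (s : Finset ι) (hs : ∀ i, i ∈ s ↔ x i ∈ F) :
    F = convexHull ℝ (x '' s) := by
  classical
  refine Set.Subset.antisymm (fun y hy => ?_) (convexHull_min ?_ hc)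
  · obtain ⟨w, hw0, hw1, rfl⟩ := mem_convexHull_range_iff_exists_weights.1 (hF.subset hy)
    refine mem_convexHull_image_of_weights hw0 hw1 fun i hi => ?_
    by_contra hwi
    have hpos : 0 < w i := lt_of_le_of_ne (hw0 i) (Ne.symm hwi)
    apply hi
    rw [hs]
    have hsplit : ∑ k ∈ Finset.univ.erase i, w k + w i = 1 := by
      rw [← hw1, Finset.sum_erase_add _ _ (Finset.mem_univ i)]
    have hsplit' : ∑ k ∈ Finset.univ.erase i, w k • x k + w i • x i = ∑ k, w k • x k :=
      Finset.sum_erase_add _ _ (Finset.mem_univ i)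
    rcases (hw0 i).eq_or_lt with h | _
    · exact absurd h.symm hwi
    have hnn : 0 ≤ ∑ k ∈ Finset.univ.erase i, w k := Finset.sum_nonneg fun k _ => hw0 k
    rcases hnn.eq_or_lt with h0 | h0
    · have hz := (Finset.sum_eq_zero_iff_of_nonneg fun k _ => hw0 k).1 h0.symm
      have : ∑ k ∈ Finset.univ.erase i, w k • x k = 0 :=
        Finset.sum_eq_zero fun k hk => by simp [hz k hk]
      rw [this, zero_add] at hsplit'
      have hwi1 : w i = 1 := by linarith
      rw [hwi1, one_smul] at hsplit'
      rw [hsplit']; exact hy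
    · set a := ∑ k ∈ Finset.univ.erase i, w k with ha
      have hz : a⁻¹ • ∑ k ∈ Finset.univ.erase i, w k • x k ∈ convexHull ℝ (Set.range x) := by
        have := Finset.centerMass_mem_convexHull (R := ℝ) (Finset.univ.erase i) (w := w) (z := x)
          (s := Set.range x) (fun k _ => hw0 k) h0 (fun k _ => Set.mem_range_self k)
        rwa [Finset.centerMass, ← ha] at this
      refine hF.left_mem_of_mem_openSegment
        (subset_convexHull ℝ _ (Set.mem_range_self i)) hz hy ⟨w i, a, hpos, h0, by linarith, ?_⟩
      rw [smul_smul, mul_inv_cancel₀ h0.ne', one_smul, ← hsplit', add_comm]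
  · rintro _ ⟨i, hi, rfl⟩
    exact (hs i).1 hi

theorem IsExtreme.disjoint_interior {P F : Set V} (hF : IsExtreme ℝ P F) (hne : F ≠ P) :
    Disjoint (interior P) F := by
  rw [Set.disjoint_left]
  intro z hz hzF
  apply hne
  refine Set.Subset.antisymm hF.subset fun p hp => ?_
  have hcont : Tendsto (fun t : ℝ => z + t • (z - p)) (nhds 0) (nhds z) := by
    have : Continuous fun t : ℝ => z + t • (z - p) := by fun_prop
    simpa using this.tendsto 0
  have hev : ∀ᶠ t in nhdsWithin (0 : ℝ) (Set.Ioi 0), z + t • (z - p) ∈ interior P :=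
    nhdsWithin_le_nhds (hcont (isOpen_interior.mem_nhds hz))
  obtain ⟨t, ht0, ht⟩ := (hev.and self_mem_nhdsWithin).exists
  refine hF.left_mem_of_mem_openSegment hp (interior_subset ht0) hzF
    ⟨t / (1 + t), 1 / (1 + t), by positivity, by positivity, by field_simp; ring, ?_⟩
  rw [smul_add, ← add_assoc, smul_smul, smul_sub]
  have h1 : (1 / (1 + t) * t) = t / (1 + t) := by ring
  rw [h1]
  have h2 : (t / (1 + t)) • p + (1 / (1 + t)) • z + ((t / (1 + t)) • z - (t / (1 + t)) • p) =
    (1 / (1 + t) + t / (1 + t)) • z := by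
    rw [add_smul]; abel
  rw [h2]
  convert one_smul ℝ z
  field_simp

variable [FiniteDimensional ℝ V]

theorem GenPos.affineSpan_eq_top [Fintype ι] {x : ι → V} (hx : GenPos x)
    (hι : finrank ℝ V + 1 ≤ Fintype.card ι) : affineSpan ℝ (Set.range x) = ⊤ := by
  classical
  obtain ⟨s, -, hs⟩ := Finset.exists_subset_card_eq (hι.trans_eq Finset.card_univ.symm)
  have h1 := hx s hs.le
  have h2 : affineSpan ℝ (Set.range fun i : s => x i) = ⊤ :=
    h1.affineSpan_eq_top_iff_card_eq_finrank_add_one.2 (by simp [hs])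
  rw [eq_top_iff, ← h2]
  apply affineSpan_mono
  rintro _ ⟨i, rfl⟩
  exact Set.mem_range_self _

theorem IsExtreme.supports [Fintype ι] {x : ι → V} (hx : affineSpan ℝ (Set.range x) = ⊤)
    {F : Set V} (hc : Convex ℝ F)
    (hF : IsExtreme ℝ (convexHull ℝ (Set.range x)) F) (hne : F ≠ convexHull ℝ (Set.range x))
    {s : Finset ι} (hs : ∀ i ∈ s, x i ∈ F) : Supports x s := by
  set P := convexHull ℝ (Set.range x) with hP
  have hPc : Convex ℝ P := convex_convexHull ℝ _
  have hint : (interior P).Nonempty := interior_convexHull_nonempty_iff_affineSpan_eq_top.2 hx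
  obtain ⟨f, u, hfu, hfF⟩ := geometric_hahn_banach_open hPc.interior isOpen_interior hc
    (hF.disjoint_interior hne)
  have hle : ∀ a ∈ P, f a ≤ u := by
    intro a ha
    have h1 : a ∈ closure (interior P) := by
      rw [hPc.closure_interior_eq_closure_of_nonempty_interior hint]
      exact subset_closure ha
    have h2 : closure (interior P) ⊆ {a | f a ≤ u} :=
      closure_minimal (fun a ha => (hfu a ha).le) (isClosed_le f.continuous continuous_const)
    exact h2 h1
  refine ⟨u • LinearMap.snd ℝ V ℝ - f.toLinearMap.comp (LinearMap.fst ℝ V ℝ), ?_, ?_, ?_⟩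
  · intro h0
    obtain ⟨z, hz⟩ := hint
    have h1 := LinearMap.congr_fun h0 (z, 1)
    have h2 := hfu z hz
    simp at h1
    linarith
  · intro i
    have := hle (x i) (subset_convexHull ℝ _ (Set.mem_range_self i))
    simp [this]
  · intro i hi
    have h1 := hle (x i) (subset_convexHull ℝ _ (Set.mem_range_self i))
    have h2 := hfF (x i) (hs i hi)
    simp; linarith

/-- In general position, the `j`-faces of a polytope correspond to the supported `(j+1)`-subsets
of the generating points. -/
theorem GenPos.faceCount_eq [Fintype ι] [DecidableEq ι] {x : ι → V} (hx : GenPos x)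
    (hι : finrank ℝ V + 1 ≤ Fintype.card ι) {j : ℕ} (hj : j < finrank ℝ V)
    [DecidablePred (Supports x)] :
    faceCount (convexHull ℝ (Set.range x)) j =
      ((Finset.univ.powersetCard (j + 1)).filter (Supports x)).card := by
  classical
  have hdim : ∀ s : Finset ι, ∀ k, s.card = k + 1 → k ≤ finrank ℝ V →
      finrank ℝ (vectorSpan ℝ (convexHull ℝ (x '' s))) = k := by
    intro s k hs hk
    rw [← direction_affineSpan, affineSpan_convexHull, direction_affineSpan]
    have := (hx s (by omega)).finrank_vectorSpan (n := k) (by simp [hs])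
    rw [← this, Set.image_eq_range]
    rfl
  let S := (Finset.univ.powersetCard (j + 1)).filter (Supports x)
  have hS : ∀ I, I ∈ S ↔ I.card = j + 1 ∧ Supports x I := by
    intro I; simp [S, Finset.mem_powersetCard]
  let φ : S → {F : Set V // F.Nonempty ∧ Convex ℝ F ∧
      IsExtreme ℝ (convexHull ℝ (Set.range x)) F ∧ finrank ℝ (vectorSpan ℝ F) = j} := fun I =>
    ⟨convexHull ℝ (x '' I.1), by
      obtain ⟨hIc, hIs⟩ := (hS I.1).1 I.2
      obtain ⟨f, hf0, hfp⟩ := hx.exists_exact hIs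
      refine ⟨?_, convex_convexHull ℝ _, isExtreme_convexHull_image hf0 hfp,
        hdim _ _ hIc (by omega)⟩
      rw [convexHull_nonempty_iff, Set.image_nonempty, Finset.coe_nonempty, ← Finset.card_pos]
      omega⟩
  have hφ : Function.Bijective φ := by
    constructor
    · intro I J hIJ
      have key : ∀ I J : S, convexHull ℝ (x '' I.1) = convexHull ℝ (x '' J.1) → I.1 ⊆ J.1 := by
        intro I J h i hi
        obtain ⟨hJc, hJs⟩ := (hS J.1).1 J.2
        obtain ⟨f, hf0, hfp⟩ := hx.exists_exact hJs
        have h1 : x i ∈ convexHull ℝ (x '' J.1) := h ▸ subset_convexHull ℝ _ ⟨i, hi, rfl⟩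
        have h2 := dual_lift_eq_zero_of_mem_convexHull hf0 h1
        by_contra hiJ
        exact (hfp i hiJ).ne' h2
      have h := congrArg Subtype.val hIJ
      exact Subtype.ext (Finset.Subset.antisymm (key I J h) (key J I h.symm))
    · rintro ⟨F, hFne, hFc, hFe, hFd⟩
      let s : Finset ι := Finset.univ.filter fun i => x i ∈ F
      have hs : ∀ i, i ∈ s ↔ x i ∈ F := by simp [s]
      have hFs := hFe.convexHull_eq hFc s hs
      have hspos : s.card ≠ 0 := by
        intro h0
        rw [Finset.card_eq_zero] at h0
        rw [h0] at hFs
        simp at hFs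
        exact hFne.ne_empty hFs
      have hcard : s.card = j + 1 := by
        rcases le_or_gt s.card (finrank ℝ V + 1) with hle | hlt
        · have := hdim s (s.card - 1) (by omega) (by omega)
          rw [← hFs, hFd] at this
          omega
        · obtain ⟨t, hts, htc⟩ := Finset.exists_subset_card_eq hlt.le
          have h1 := hdim t (finrank ℝ V) htc le_rfl
          have h2 : vectorSpan ℝ (convexHull ℝ (x '' t)) ≤ vectorSpan ℝ F := by
            rw [hFs]
            exact vectorSpan_mono ℝ (convexHull_mono (Set.image_mono hts))
          have h3 := Submodule.finrank_mono h2
          omega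
      have hspan := hx.affineSpan_eq_top hι
      have hne : F ≠ convexHull ℝ (Set.range x) := by
        intro h
        rw [h, ← direction_affineSpan, affineSpan_convexHull, hspan] at hFd
        rw [AffineSubspace.direction_top, finrank_top] at hFd
        omega
      refine ⟨⟨s, (hS s).2 ⟨hcard, hFe.supports hspan hFc hne fun i hi => (hs i).1 hi⟩⟩, ?_⟩
      exact Subtype.ext hFs.symm
  rw [faceCount, ← Nat.card_congr (Equiv.ofBijective φ hφ), Nat.card_eq_fintype_card, Fintype.card_coe]

end Faces

end

section

open Module

section MeasurabilityGeneralPosition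

variable {ι V : Type*} [NormedAddCommGroup V] [NormedSpace ℝ V] [FiniteDimensional ℝ V]

theorem isClosed_supports [Fintype ι] (I : Finset ι) : IsClosed {x : ι → V | Supports x I} := by
  let S := Metric.sphere (0 : StrongDual ℝ (V × ℝ)) 1
  have hfin : FiniteDimensional ℝ (StrongDual ℝ (V × ℝ)) := inferInstance
  have hprop : ProperSpace (StrongDual ℝ (V × ℝ)) := FiniteDimensional.proper_real _
  have hS : CompactSpace S := isCompact_iff_compactSpace.1 (isCompact_sphere _ _)
  let T : Set (S × (ι → V)) := {q | (∀ i, 0 ≤ q.1.1 (q.2 i, 1)) ∧ ∀ i ∈ I, q.1.1 (q.2 i, 1) = 0}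
  have hcont : ∀ i, Continuous fun q : S × (ι → V) => q.1.1 (q.2 i, (1 : ℝ)) := by
    intro i
    exact (continuous_subtype_val.comp continuous_fst).clm_apply (by fun_prop)
  have hT : IsClosed T := by
    have : T = (⋂ i, {q | 0 ≤ q.1.1 (q.2 i, 1)}) ∩ ⋂ i ∈ I, {q | q.1.1 (q.2 i, 1) = 0} := by
      ext q; simp [T]
    rw [this]
    exact (isClosed_iInter fun i => isClosed_le continuous_const (hcont i)).inter
      (isClosed_biInter fun i _ => isClosed_eq (hcont i) continuous_const)
  have himg : {x : ι → V | Supports x I} = Prod.snd '' T := by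
    ext x
    constructor
    · rintro ⟨f, hf0, hfn, hfI⟩
      let g := LinearMap.toContinuousLinearMap f
      have hg0 : g ≠ 0 := by simpa [g] using hf0
      have hgn : 0 < ‖g‖ := norm_pos_iff.2 hg0
      have hgf : ∀ v, g v = f v := fun v => rfl
      refine ⟨(⟨‖g‖⁻¹ • g, by simp [S, norm_smul, hgn.ne']⟩, x), ⟨fun i => ?_, fun i hi => ?_⟩, rfl⟩
      · simp only [smul_apply, smul_eq_mul, hgf]
        exact mul_nonneg (inv_nonneg.2 hgn.le) (hfn i)
      · simp [hgf, hfI i hi]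
    · rintro ⟨⟨⟨g, hg⟩, x⟩, ⟨h1, h2⟩, rfl⟩
      refine ⟨g.toLinearMap, ?_, h1, h2⟩
      intro h0
      have : g = 0 := by
        ext v <;> simpa using LinearMap.congr_fun h0 _
      simp [this, S] at hg
  rw [himg]
  exact isClosedMap_snd_of_compactSpace _ hT

omit [FiniteDimensional ℝ V] in
theorem isClosed_not_affineIndependent (s : Finset ι) :
    IsClosed {x : ι → V | ¬ AffineIndependent ℝ (fun i : s => x i)} := by
  let S := Metric.sphere (0 : s → ℝ) 1
  have hS : CompactSpace S := isCompact_iff_compactSpace.1 (isCompact_sphere _ _)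
  let T : Set (S × (ι → V)) := {q | ∑ i, q.1.1 i = 0 ∧ ∑ i, q.1.1 i • q.2 i = 0}
  have hT : IsClosed T := by
    apply IsClosed.inter
    · exact isClosed_eq (by fun_prop) continuous_const
    · exact isClosed_eq (continuous_finsetSum _ fun i _ =>
        ((continuous_apply i).comp (continuous_subtype_val.comp continuous_fst)).smul
          ((continuous_apply _).comp continuous_snd)) continuous_const
  have himg : {x : ι → V | ¬ AffineIndependent ℝ (fun i : s => x i)} = Prod.snd '' T := by
    ext x
    constructor
    · intro hx
      rw [Set.mem_ofPred_eq, affineIndependent_iff_of_fintype] at hx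
      push Not at hx
      obtain ⟨w, hw0, hwx, i, hi⟩ := hx
      rw [Finset.univ.weightedVSub_eq_linear_combination hw0] at hwx
      have hwn : 0 < ‖w‖ := norm_pos_iff.2 fun h => hi (by simp [h])
      refine ⟨(⟨‖w‖⁻¹ • w, by simp [S, norm_smul, hwn.ne']⟩, x), ⟨?_, ?_⟩, rfl⟩
      · simp only [Pi.smul_apply, smul_eq_mul, ← Finset.mul_sum, hw0, mul_zero]
      · simp only [Pi.smul_apply, smul_eq_mul, mul_smul, ← Finset.smul_sum, hwx, smul_zero]
    · rintro ⟨⟨⟨w, hw⟩, x⟩, ⟨h1, h2⟩, rfl⟩ hAI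
      have := affineIndependent_iff.1 hAI Finset.univ w h1 h2
      have hw0 : w = 0 := funext fun i => this i (Finset.mem_univ i)
      simp [hw0, S] at hw
  rw [himg]
  exact isClosedMap_snd_of_compactSpace _ hT

end MeasurabilityGeneralPosition

section Fubini

variable {ι V : Type*} [Fintype ι] [MeasurableSpace V]

/-- Recombine a family indexed by `{i // p i}` and one indexed by `{i // ¬ p i}`. -/
abbrev glue (p : ι → Prop) [DecidablePred p] (a : {i // p i} → V) (b : {i // ¬ p i} → V) : ι → V :=
  fun i => if h : p i then a ⟨i, h⟩ else b ⟨i, h⟩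

theorem measure_pi_eq_lintegral_glue (μ : Measure V) [SigmaFinite μ] (p : ι → Prop)
    [DecidablePred p] [i₁ : Fintype {i // p i}] [i₂ : Fintype {i // ¬ p i}]
    {S : Set (ι → V)} (hS : MeasurableSet S) :
    Measure.pi (fun _ : ι => μ) S =
      ∫⁻ a, Measure.pi (fun _ : {i // ¬ p i} => μ) {b | glue p a b ∈ S}
        ∂(Measure.pi fun _ : {i // p i} => μ) := by
  obtain rfl : i₁ = Subtype.fintype p := Subsingleton.elim _ _
  obtain rfl : i₂ = Subtype.fintype fun i => ¬ p i := Subsingleton.elim _ _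
  have h := measurePreserving_piEquivPiSubtypeProd (fun _ : ι => μ) p
  have h' := h.symm
  rw [← h'.measure_preimage hS.nullMeasurableSet, Measure.prod_apply (h'.measurable hS)]
  rfl

end Fubini

end

section

open Module

section GeneralPosition

variable {ι V : Type*} [NormedAddCommGroup V] [NormedSpace ℝ V] [FiniteDimensional ℝ V]

omit [FiniteDimensional ℝ V] in
theorem affineIndependent_insert [DecidableEq ι] {x : ι → V} {s : Finset ι} {k : ι}
    (hs : AffineIndependent ℝ (fun i : s => x i)) (hk : x k ∉ affineSpan ℝ (x '' s)) :
    AffineIndependent ℝ (fun i : (insert k s : Finset ι) => x i) := by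
  apply AffineIndependent.affineIndependent_of_notMem_span
    (i := (⟨k, Finset.mem_insert_self k s⟩ : (insert k s : Finset ι)))
  · let e : {y : (insert k s : Finset ι) // y ≠ ⟨k, Finset.mem_insert_self k s⟩} ↪ s :=
      ⟨fun y => ⟨y.1.1, (Finset.mem_insert.1 y.1.2).resolve_left fun h => y.2 (Subtype.ext h)⟩,
        fun y z h => by
          apply Subtype.ext; apply Subtype.ext; simpa using h⟩
    exact hs.comp_embedding e
  · intro h
    apply hk
    refine affineSpan_mono ℝ ?_ h
    rintro _ ⟨y, hy, rfl⟩
    exact ⟨y.1, (Finset.mem_insert.1 y.2).resolve_left fun h => hy (Subtype.ext h), rfl⟩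

omit [FiniteDimensional ℝ V] in
theorem affineSpan_image_ne_top {x : ι → V} {s : Finset ι} (hs : s.card ≤ finrank ℝ V) :
    affineSpan ℝ (x '' s) ≠ ⊤ := by
  classical
  intro h
  rcases s.eq_empty_or_nonempty with rfl | hne
  · simp at h
  · obtain ⟨n, hn⟩ := Nat.exists_eq_succ_of_ne_zero hne.card_ne_zero
    have h1 : finrank ℝ (vectorSpan ℝ (x '' s)) ≤ n := by
      rw [← Finset.coe_image]
      exact finrank_vectorSpan_image_finset_le ℝ x s hn
    have h2 := congrArg AffineSubspace.direction h
    rw [direction_affineSpan, AffineSubspace.direction_top] at h2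
    rw [h2, finrank_top] at h1
    omega

variable [MeasurableSpace V] [BorelSpace V] [Fintype ι]

theorem ae_affineIndependent [SecondCountableTopology V] {μ : Measure V} [IsProbabilityMeasure μ]
    (hμ : ∀ A : AffineSubspace ℝ V, A ≠ ⊤ → μ A = 0) (s : Finset ι)
    (hs : s.card ≤ finrank ℝ V + 1) :
    ∀ᵐ x ∂(Measure.pi fun _ : ι => μ), AffineIndependent ℝ (fun i : s => x i) := by
  classical
  induction s using Finset.induction_on with
  | empty =>
    refine .of_forall fun x => ?_
    have : Subsingleton ((∅ : Finset ι) : Type _) := ⟨fun a => absurd a.2 (Finset.notMem_empty _)⟩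
    exact affineIndependent_of_subsingleton ℝ _
  | insert k s hk ih =>
    rw [Finset.card_insert_of_notMem hk] at hs
    have ih := ih (by omega)
    let B : Set (ι → V) := {x | ¬ AffineIndependent ℝ (fun i : (insert k s : Finset ι) => x i)} ∩
      {x | ¬ AffineIndependent ℝ (fun i : s => x i)}ᶜ
    have hB : MeasurableSet B := (isClosed_not_affineIndependent _).measurableSet.inter
      (isClosed_not_affineIndependent _).measurableSet.compl
    have hB0 : Measure.pi (fun _ : ι => μ) B = 0 := by
      rw [measure_pi_eq_lintegral_glue μ (· ≠ k) hB]
      refine lintegral_eq_zero_of_ae_eq_zero (.of_forall fun a => ?_)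
      have hks : ∀ i ∈ s, i ≠ k := fun i hi h => hk (h ▸ hi)
      let y : ι → V := fun i => if h : i ≠ k then a ⟨i, h⟩ else 0
      have hA : affineSpan ℝ (y '' s) ≠ ⊤ := affineSpan_image_ne_top (by omega)
      let k' : {i // ¬ i ≠ k} := ⟨k, fun h => h rfl⟩
      refine measure_mono_null (t := Function.eval k' ⁻¹' (affineSpan ℝ (y '' s) : Set V)) ?_ ?_
      · rintro b ⟨hb1, hb2⟩
        have hb2 := not_not.1 hb2
        by_contra hb3
        refine hb1 (affineIndependent_insert hb2 fun h => hb3 ?_)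
        have hxy : glue (· ≠ k) a b '' s = y '' s := by
          refine Set.image_congr fun i hi => ?_
          simp [glue, y, hks i hi]
        rw [hxy] at h
        simpa [glue, k'] using h
      · rw [(measurePreserving_eval (fun _ : {i // ¬ i ≠ k} => μ) k').measure_preimage]
        · exact hμ _ hA
        · exact (AffineSubspace.closed_of_finiteDimensional _).measurableSet.nullMeasurableSet
    have : ∀ᵐ x ∂(Measure.pi fun _ : ι => μ), x ∉ B := measure_eq_zero_iff_ae_notMem.1 hB0
    filter_upwards [ih, this] with x h1 h2
    by_contra h3
    exact h2 ⟨h3, fun h => h h1⟩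

theorem ae_genPos [SecondCountableTopology V] {μ : Measure V} [IsProbabilityMeasure μ]
    (hμ : ∀ A : AffineSubspace ℝ V, A ≠ ⊤ → μ A = 0) :
    ∀ᵐ x ∂(Measure.pi fun _ : ι => μ), GenPos x := by
  have h := fun s : Finset ι => ae_affineIndependent (ι := ι) hμ s
  simp only [GenPos]
  rw [ae_all_iff]
  intro s
  by_cases hs : s.card ≤ finrank ℝ V + 1
  · filter_upwards [h s hs] with x hx _ using hx
  · exact .of_forall fun x h => absurd h hs

end GeneralPosition

end

section

open Module

section ExpectedFaceCount

variable {ι V : Type*} [NormedAddCommGroup V] [NormedSpace ℝ V] [FiniteDimensional ℝ V]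
  [MeasurableSpace V] [BorelSpace V] [SecondCountableTopology V] [Fintype ι]

theorem integral_faceCount_eq {μ : Measure V} [IsProbabilityMeasure μ]
    (hμ : ∀ A : AffineSubspace ℝ V, A ≠ ⊤ → μ A = 0) (hι : finrank ℝ V + 1 ≤ Fintype.card ι)
    {j : ℕ} (hj : j < finrank ℝ V) :
    ∫ x : ι → V, (faceCount (convexHull ℝ (Set.range x)) j : ℝ) ∂(Measure.pi fun _ : ι => μ) =
      ∑ I ∈ Finset.univ.powersetCard (j + 1),
        (Measure.pi fun _ : ι => μ).real {x | Supports x I} := by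
  classical
  have h : (fun x : ι → V => (faceCount (convexHull ℝ (Set.range x)) j : ℝ)) =ᵐ[Measure.pi
      fun _ : ι => μ] fun x => ∑ I ∈ Finset.univ.powersetCard (j + 1),
        {x | Supports x I}.indicator (1 : (ι → V) → ℝ) x := by
    filter_upwards [ae_genPos (ι := ι) hμ] with x hx
    rw [hx.faceCount_eq hι hj, Finset.card_filter]
    push_cast
    refine Finset.sum_congr rfl fun I _ => ?_
    simp [Set.indicator_apply]
  rw [integral_congr_ae h, integral_finsetSum]
  · exact Finset.sum_congr rfl fun I _ =>
      integral_indicator_one (isClosed_supports I).measurableSet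
  · intro I _
    exact (integrable_const (1 : ℝ)).indicator (isClosed_supports I).measurableSet

omit [BorelSpace V] [SecondCountableTopology V] in
theorem sum_measureReal_supports_le (P : Measure (ι → V)) [IsFiniteMeasure P]
    (hι : finrank ℝ V ≤ Fintype.card ι) {c c' : ℕ} (hcc : c ≤ c') (hc : c' ≤ finrank ℝ V) :
    ∑ I ∈ Finset.univ.powersetCard c, P.real {x | Supports x I} ≤
      c'.choose c * ∑ J ∈ Finset.univ.powersetCard c', P.real {x | Supports x J} := by
  classical
  calc ∑ I ∈ Finset.univ.powersetCard c, P.real {x | Supports x I}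
      ≤ ∑ I ∈ Finset.univ.powersetCard c, ∑ J ∈ Finset.univ.powersetCard c',
        if I ⊆ J then P.real {x | Supports x J} else 0 := by
        refine Finset.sum_le_sum fun I hI => ?_
        rw [← Finset.sum_filter]
        refine le_trans (measureReal_mono ?_ (measure_ne_top _ _)) (measureReal_biUnion_finset_le _ _)
        intro x hx
        obtain ⟨t, ht, htc, hxt⟩ := Supports.exists_superset_card_eq hx hι
          ((Finset.mem_powersetCard.1 hI).2.trans_le hcc) hc
        exact Set.mem_iUnion₂.2 ⟨t, by simp [ht, htc], hxt⟩
    _ = ∑ J ∈ Finset.univ.powersetCard c', ∑ I ∈ Finset.univ.powersetCard c,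
        if I ⊆ J then P.real {x | Supports x J} else 0 := Finset.sum_comm
    _ = c'.choose c * ∑ J ∈ Finset.univ.powersetCard c', P.real {x | Supports x J} := by
        rw [Finset.mul_sum]
        refine Finset.sum_congr rfl fun J hJ => ?_
        rw [← Finset.sum_filter, Finset.sum_const, nsmul_eq_mul]
        congr 2
        rw [← (Finset.mem_powersetCard.1 hJ).2, ← Finset.card_powersetCard]
        congr 1
        ext I
        simp [Finset.mem_powersetCard, and_comm]

end ExpectedFaceCount

end

section

open Module

theorem exists_ker_eq_span_singleton {W U : Type*} [AddCommGroup W] [Module ℝ W]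
    [FiniteDimensional ℝ W] [AddCommGroup U] [Module ℝ U] {Φ : W →ₗ[ℝ] U}
    (hΦ : Function.Surjective Φ) (h : finrank ℝ W = finrank ℝ U + 1) :
    ∃ v : W, v ≠ 0 ∧ Φ v = 0 ∧ ∀ w, Φ w = 0 → ∃ c : ℝ, w = c • v := by
  have h1 := Φ.finrank_range_add_finrank_ker
  rw [LinearMap.range_eq_top.2 hΦ, finrank_top] at h1
  have h2 : finrank ℝ (LinearMap.ker Φ) = 1 := by omega
  obtain ⟨v, hv, hw⟩ := finrank_eq_one_iff'.1 h2
  refine ⟨v, by simpa using hv, LinearMap.mem_ker.1 v.2, fun w hw0 => ?_⟩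
  obtain ⟨c, hc⟩ := hw ⟨w, LinearMap.mem_ker.2 hw0⟩
  exact ⟨c, (congrArg Subtype.val hc).symm⟩

section SupportingHyperplane

variable {ι V : Type*} [NormedAddCommGroup V] [NormedSpace ℝ V] [FiniteDimensional ℝ V]

theorem AffineIndependent.exists_dual_unique {κ : Type*} [Fintype κ] {a : κ → V}
    (ha : AffineIndependent ℝ a) (hκ : Fintype.card κ = finrank ℝ V) :
    ∃ f₀ : Dual ℝ (V × ℝ), f₀ ≠ 0 ∧ (∀ l, f₀ (a l, 1) = 0) ∧
      ∀ f : Dual ℝ (V × ℝ), (∀ l, f (a l, 1) = 0) → ∃ c : ℝ, f = c • f₀ := by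
  let Φ : Dual ℝ (V × ℝ) →ₗ[ℝ] (κ → ℝ) :=
    LinearMap.pi fun i => Dual.eval ℝ (V × ℝ) (a i, 1)
  have hΦ : ∀ f i, Φ f i = f (a i, 1) := fun f i => rfl
  have hsurj : LinearMap.range Φ = ⊤ := by
    rw [LinearMap.range_eq_top]
    intro c
    obtain ⟨g, hg⟩ := ha.linearIndependent_lift.exists_dual_eq c
    exact ⟨g, funext hg⟩
  obtain ⟨v, hv, hv0, hw⟩ := exists_ker_eq_span_singleton (LinearMap.range_eq_top.1 hsurj)
    (by rw [Subspace.dual_finrank_eq, finrank_prod, finrank_self, finrank_fintype_fun_eq_card, hκ])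
  exact ⟨v, hv, fun l => congrFun hv0 l, fun f hf => hw f (funext hf)⟩

variable [MeasurableSpace V] [BorelSpace V]

omit [BorelSpace V] in
theorem pi_forall_notMem_le {κ : Type*} [Fintype κ] {μ : Measure V} [IsProbabilityMeasure μ]
    {S : Set V} (hS : MeasurableSet S) {q : ℝ} (hq : q ≤ μ.real S) :
    (Measure.pi fun _ : κ => μ) {b | ∀ l, b l ∉ S} ≤
      ENNReal.ofReal (Real.exp (-(Fintype.card κ * q))) := by
  have h1 : {b : κ → V | ∀ l, b l ∉ S} = Set.univ.pi fun _ => Sᶜ := by ext; simp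
  rw [h1, Measure.pi_pi, Finset.prod_const, Finset.card_univ,
    ← ENNReal.ofReal_toReal (measure_ne_top μ Sᶜ), ← ENNReal.ofReal_pow ENNReal.toReal_nonneg]
  apply ENNReal.ofReal_le_ofReal
  have h2 : (μ Sᶜ).toReal ≤ Real.exp (-q) := by
    rw [← measureReal_def, probReal_compl_eq_one_sub hS]
    linarith [Real.add_one_le_exp (-q)]
  calc _ ≤ Real.exp (-q) ^ Fintype.card κ := by gcongr
    _ = _ := by rw [← Real.exp_nat_mul]; congr 1; ring

theorem pi_supports_section_le [Fintype ι] [DecidableEq ι] {μ : Measure V}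
    [IsProbabilityMeasure μ] {J : Finset ι} (hJ : J.card = finrank ℝ V) {a : {i // i ∈ J} → V}
    (ha : AffineIndependent ℝ a) {q : ℝ}
    (hq : ∀ f : Dual ℝ (V × ℝ), f ≠ 0 → (∀ l, f (a l, 1) = 0) → q ≤ μ.real {y | f (y, 1) < 0}) :
    (Measure.pi fun _ : {i // i ∉ J} => μ) {b | Supports (glue (· ∈ J) a b) J} ≤
      ENNReal.ofReal (2 * Real.exp (-((Fintype.card ι - finrank ℝ V : ℕ) * q))) := by
  obtain ⟨f₀, hf0, hfa, hfu⟩ := ha.exists_dual_unique (by simpa using hJ)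
  have hcard : Fintype.card {i // i ∉ J} = Fintype.card ι - finrank ℝ V := by
    rw [Fintype.card_subtype_compl, Fintype.card_coe, hJ]
  have hmeas : ∀ f : Dual ℝ (V × ℝ), MeasurableSet {y : V | f (y, 1) < 0} := by
    intro f
    have hf : Continuous f := f.continuous_of_finiteDimensional
    exact (isOpen_lt (hf.comp (by fun_prop)) continuous_const).measurableSet
  have key : ∀ f : Dual ℝ (V × ℝ), f ≠ 0 → (∀ l, f (a l, 1) = 0) →
      (Measure.pi fun _ : {i // i ∉ J} => μ) {b | ∀ l, b l ∉ {y | f (y, 1) < 0}} ≤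
      ENNReal.ofReal (Real.exp (-((Fintype.card ι - finrank ℝ V : ℕ) * q))) := by
    intro f h0 h1
    rw [← hcard]
    exact pi_forall_notMem_le (hmeas f) (hq f h0 h1)
  have hsub : {b : {i // i ∉ J} → V | Supports (glue (· ∈ J) a b) J} ⊆
      {b | ∀ l, b l ∉ {y | f₀ (y, 1) < 0}} ∪ {b | ∀ l, b l ∉ {y | (-f₀) (y, 1) < 0}} := by
    rintro b ⟨f, hf, hfn, hfz⟩
    obtain ⟨c, rfl⟩ := hfu f fun l => by simpa [glue, l.2] using hfz l l.2
    have hb : ∀ l : {i // i ∉ J}, 0 ≤ c * f₀ (b l, 1) := fun l => by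
      simpa [glue, l.2] using hfn l
    rcases lt_trichotomy c 0 with hc | hc | hc
    · right
      intro l
      simpa using nonpos_of_mul_nonneg_right (hb l) hc
    · simp [hc] at hf
    · left
      intro l
      simpa using nonneg_of_mul_nonneg_right (hb l) hc
  calc _ ≤ _ := measure_mono hsub
    _ ≤ _ := measure_union_le _ _
    _ ≤ _ := add_le_add (key f₀ hf0 hfa) (key (-f₀) (by simpa using hf0) (by simpa using hfa))
    _ = _ := by rw [← ENNReal.ofReal_add (by positivity) (by positivity)]; congr 1; ring

theorem pi_supports_le_lintegral [SecondCountableTopology V] [Fintype ι] [DecidableEq ι]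
    {μ : Measure V} [IsProbabilityMeasure μ]
    (hμ : ∀ A : AffineSubspace ℝ V, A ≠ ⊤ → μ A = 0) {J : Finset ι} (hJ : J.card = finrank ℝ V)
    {Q : ({i // i ∈ J} → V) → ℝ}
    (hQ : ∀ᵐ a ∂(Measure.pi fun _ : {i // i ∈ J} => μ), ∀ f : Dual ℝ (V × ℝ), f ≠ 0 →
      (∀ l, f (a l, 1) = 0) → Q a ≤ μ.real {y | f (y, 1) < 0}) :
    (Measure.pi fun _ : ι => μ) {x | Supports x J} ≤
      ∫⁻ a, ENNReal.ofReal (2 * Real.exp (-((Fintype.card ι - finrank ℝ V : ℕ) * Q a)))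
        ∂(Measure.pi fun _ : {i // i ∈ J} => μ) := by
  rw [measure_pi_eq_lintegral_glue μ (· ∈ J) (isClosed_supports J).measurableSet]
  refine lintegral_mono_ae ?_
  filter_upwards [hQ, ae_affineIndependent (ι := {i // i ∈ J}) hμ Finset.univ (by simp [hJ])]
    with a h1 h2
  refine pi_supports_section_le hJ ?_ h1
  exact h2.comp_embedding ⟨fun i => ⟨i, Finset.mem_univ i⟩, fun _ _ h =>
    congrArg Subtype.val h⟩

end SupportingHyperplane

end

section

open Module

section ProductOfBalls

variable {m : ℕ} (dv : Fin m → ℕ)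

theorem uniformDist_prodOfBalls :
    uniformDist (prodOfBalls dv) = Measure.pi fun i => ballDist (dv i) := by
  symm
  apply Measure.pi_eq
  intro s hs
  rw [uniformDist, Measure.smul_apply, smul_eq_mul, Measure.restrict_apply (.univ_pi hs),
    prodOfBalls, ← Set.pi_inter_distrib, volume_pi, Measure.pi_pi, Measure.pi_pi]
  rw [ENNReal.prod_inv_distrib fun i _ j _ _ => .inl (volume_closedBall_one_ne_zero _),
    ← Finset.prod_mul_distrib]
  refine Finset.prod_congr rfl fun i _ => ?_
  rw [ballDist, uniformDist, Measure.smul_apply, smul_eq_mul, Measure.restrict_apply (hs i)]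

instance isProbabilityMeasure_uniformDist_prodOfBalls :
    IsProbabilityMeasure (uniformDist (prodOfBalls dv)) := by
  rw [uniformDist_prodOfBalls]; infer_instance

theorem uniformDist_prodOfBalls_affineSubspace
    (A : AffineSubspace ℝ (Π i, EuclideanSpace ℝ (Fin (dv i)))) (hA : A ≠ ⊤) :
    uniformDist (prodOfBalls dv) A = 0 := by
  rw [uniformDist, Measure.smul_apply, smul_eq_mul]
  have : volume.restrict (prodOfBalls dv) (A : Set (Π i, EuclideanSpace ℝ (Fin (dv i)))) = 0 :=
    nonpos_iff_eq_zero.1 ((Measure.restrict_le_self _).trans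
      (Measure.addHaar_affineSubspace _ A hA).le)
  rw [this, mul_zero]

theorem finrank_prodSpace : finrank ℝ (Π i, EuclideanSpace ℝ (Fin (dv i))) = ∑ i, dv i := by
  rw [finrank_pi_fintype]; simp

theorem ae_norm_le_one_uniformDist :
    ∀ᵐ y ∂(uniformDist (prodOfBalls dv)), ∀ i, ‖y i‖ ≤ 1 := by
  rw [uniformDist_prodOfBalls, ae_all_iff]
  intro i
  exact (measurePreserving_eval (fun i => ballDist (dv i)) i).quasiMeasurePreserving.ae
    (ae_norm_le_one_ballDist (dv i))

theorem ae_pi_norm_le_one_uniformDist (ι : Type*) [Fintype ι] :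
    ∀ᵐ x ∂(Measure.pi fun _ : ι => uniformDist (prodOfBalls dv)), ∀ l i, ‖x l i‖ ≤ 1 := by
  rw [ae_all_iff]
  intro l
  exact (measurePreserving_eval (fun _ : ι => uniformDist (prodOfBalls dv))
    l).quasiMeasurePreserving.ae (ae_norm_le_one_uniformDist dv)

end ProductOfBalls

end

section

open Module
open scoped InnerProductSpace RealInnerProductSpace

theorem one_sub_inner_le_six_mul {E : Type*} [NormedAddCommGroup E] [InnerProductSpace ℝ E]
    {x y u : E} (hx : ‖x‖ ≤ 1) (hy : ‖y‖ ≤ 1) (hu : ‖u‖ = 1) {e : ℝ} (hxe : 1 - ⟪u, x⟫ ≤ e)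
    (hye : 1 - ⟪u, y⟫ ≤ e) : 1 - ⟪x, y⟫ ≤ 6 * e := by
  have hxy := norm_sub_sq_real x y
  have hxu := norm_sub_sq_real x u
  have hyu := norm_sub_sq_real y u
  have h1 := real_inner_le_norm u x
  have h2 := real_inner_le_norm u y
  have h3 : ‖x - y‖ ≤ ‖x - u‖ + ‖y - u‖ := by
    rw [← norm_sub_rev u y]; exact norm_sub_le_norm_sub_add_norm_sub x u y
  rw [real_inner_comm u x, hu] at hxu
  rw [real_inner_comm u y, hu] at hyu
  rw [hu] at h1 h2
  have hx0 := norm_nonneg x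
  have hy0 := norm_nonneg y
  have h4 : ‖x - y‖ ^ 2 ≤ 2 * ‖x - u‖ ^ 2 + 2 * ‖y - u‖ ^ 2 := by
    nlinarith [sq_nonneg (‖x - u‖ - ‖y - u‖), norm_nonneg (x - y)]
  nlinarith

theorem exists_unit_inner_eq {k : ℕ} (hk : 1 ≤ k) (φ : Dual ℝ (EuclideanSpace ℝ (Fin k))) :
    ∃ (r : ℝ) (u : EuclideanSpace ℝ (Fin k)), 0 ≤ r ∧ ‖u‖ = 1 ∧ ∀ v, φ v = -(r * ⟪u, v⟫) := by
  have : Nonempty (Fin k) := ⟨⟨0, hk⟩⟩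
  let w := (InnerProductSpace.toDual ℝ (EuclideanSpace ℝ (Fin k))).symm φ.toContinuousLinearMap
  have hw : ∀ v, φ v = ⟪w, v⟫ := fun v => by simp [w]
  rcases eq_or_ne w 0 with h0 | h0
  · obtain ⟨u, hu⟩ := exists_norm_eq (EuclideanSpace ℝ (Fin k)) (zero_le_one' ℝ)
    exact ⟨0, u, le_rfl, hu, fun v => by simp [hw, h0]⟩
  · have hn : ‖w‖ ≠ 0 := norm_ne_zero_iff.2 h0
    refine ⟨‖w‖, -(‖w‖⁻¹ • w), norm_nonneg _, by simp [norm_smul, hn], fun v => ?_⟩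
    rw [hw, inner_neg_left, real_inner_smul_left]
    field_simp

section ProductOfBalls

variable {m : ℕ} {dv : Fin m → ℕ}

theorem dual_prodSpace_eq (f : Dual ℝ ((Π i, EuclideanSpace ℝ (Fin (dv i))) × ℝ))
    (y : Π i, EuclideanSpace ℝ (Fin (dv i))) (t : ℝ) :
    f (y, t) = f (0, 1) * t + ∑ i, f (Pi.single i (y i), 0) := by
  have h1 : (y, t) = t • ((0 : Π i, EuclideanSpace ℝ (Fin (dv i))), (1 : ℝ)) +
      ∑ i, (Pi.single i (y i), (0 : ℝ)) := by
    ext1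
    · simp [Prod.fst_sum, Finset.univ_sum_single]
    · simp [Prod.snd_sum]
  rw [h1, map_add, map_smul, map_sum, smul_eq_mul, mul_comm]

theorem exists_dual_normal_form (hdv : ∀ i, 1 ≤ dv i)
    (f : Dual ℝ ((Π i, EuclideanSpace ℝ (Fin (dv i))) × ℝ)) :
    ∃ (s : ℝ) (r : Fin m → ℝ) (u : Π i, EuclideanSpace ℝ (Fin (dv i))),
      (∀ i, 0 ≤ r i) ∧ (∀ i, ‖u i‖ = 1) ∧
      (∀ y, f (y, 1) = -s + ∑ i, r i * (1 - ⟪u i, y i⟫)) ∧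
      (s = 0 → (∀ i, r i = 0) → f = 0) := by
  have h := fun i => exists_unit_inner_eq (hdv i)
    (f.comp ((LinearMap.inl ℝ _ ℝ).comp (LinearMap.single ℝ (fun i => EuclideanSpace ℝ (Fin (dv i))) i)))
  choose r u hr hu hf using h
  simp only [LinearMap.comp_apply, LinearMap.coe_single, LinearMap.inl_apply] at hf
  refine ⟨∑ i, r i - f (0, 1), r, u, hr, hu, fun y => ?_, fun hs hr0 => ?_⟩
  · rw [dual_prodSpace_eq]
    simp only [hf, mul_sub, Finset.sum_sub_distrib, Finset.sum_neg_distrib]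
    simp
    ring
  · simp only [hr0, Finset.sum_const_zero, zero_sub, neg_eq_zero] at hs
    apply LinearMap.ext
    rintro ⟨y, t⟩
    rw [dual_prodSpace_eq, hs]
    simp [hf, hr0]

theorem le_uniformDist_cap_product (hm : 1 ≤ m) {u : Π i, EuclideanSpace ℝ (Fin (dv i))}
    (hu : ∀ i, ‖u i‖ = 1) {D : Fin m → ℝ} (hD0 : ∀ i, 0 < D i) (hD2 : ∀ i, D i ≤ 2) :
    (∏ i, (1 / 4) ^ dv i * (1 / (2 * m) : ℝ) ^ (((dv i : ℝ) + 1) / 2)) *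
        ∏ i, D i ^ (((dv i : ℝ) + 1) / 2) ≤
      (uniformDist (prodOfBalls dv)).real {y | ∀ i, 1 - ⟪y i, u i⟫ ≤ D i / (2 * m)} := by
  have hm' : (1 : ℝ) ≤ m := by exact_mod_cast hm
  have h1 : {y : Π i, EuclideanSpace ℝ (Fin (dv i)) | ∀ i, 1 - ⟪y i, u i⟫ ≤ D i / (2 * m)} =
      Set.univ.pi fun i => {y | 1 - ⟪y, u i⟫ ≤ D i / (2 * m)} := by ext; simp
  rw [uniformDist_prodOfBalls, h1, measureReal_def, Measure.pi_pi, ENNReal.toReal_prod,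
    ← Finset.prod_mul_distrib]
  refine Finset.prod_le_prod (fun i _ => by have := hD0 i; positivity) fun i _ => ?_
  have h2 : (1 / 4 : ℝ) ^ dv i * (1 / (2 * m)) ^ (((dv i : ℝ) + 1) / 2) *
      D i ^ (((dv i : ℝ) + 1) / 2) = (1 / 4) ^ dv i * (D i / (2 * m)) ^ (((dv i : ℝ) + 1) / 2) := by
    rw [mul_assoc, ← Real.mul_rpow (by positivity) (hD0 i).le]
    congr 2; ring
  rw [h2, ← ENNReal.ofReal_le_iff_le_toReal (measure_ne_top _ _)]
  refine le_ballDist_cap (hu i) (by have := hD0 i; positivity) ?_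
  rw [div_le_iff₀ (by positivity)]
  nlinarith [hD2 i]

/-- Any half-space whose boundary passes through a family of points of `Z` that is spread out
by `D i` in the `i`-th coordinate has uniform measure at least `c * ∏ i, D i ^ ((dv i + 1) / 2)`. -/
theorem le_uniformDist_halfspace (hm : 1 ≤ m) (hdv : ∀ i, 1 ≤ dv i) {κ : Type*}
    {a : κ → Π i, EuclideanSpace ℝ (Fin (dv i))} (ha : ∀ l i, ‖a l i‖ ≤ 1) (l₀ : κ)
    {D : Fin m → ℝ} (hD0 : ∀ i, 0 ≤ D i) (hD : ∀ i, ∃ l, 6 * D i ≤ 1 - ⟪a l i, a l₀ i⟫)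
    {f : Dual ℝ ((Π i, EuclideanSpace ℝ (Fin (dv i))) × ℝ)} (hf : f ≠ 0)
    (hfa : ∀ l, f (a l, 1) = 0) :
    (∏ i, (1 / 4) ^ dv i * (1 / (2 * m) : ℝ) ^ (((dv i : ℝ) + 1) / 2)) *
        ∏ i, D i ^ (((dv i : ℝ) + 1) / 2) ≤
      (uniformDist (prodOfBalls dv)).real {y | f (y, 1) < 0} := by
  by_cases hD1 : ∃ i, D i = 0
  · obtain ⟨i, hi⟩ := hD1
    rw [Finset.prod_eq_zero (f := fun i => D i ^ (((dv i : ℝ) + 1) / 2)) (Finset.mem_univ i)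
      (by rw [hi]; exact Real.zero_rpow (by positivity)), mul_zero]
    positivity
  push Not at hD1
  have hD0' : ∀ i, 0 < D i := fun i => (hD0 i).lt_of_ne' (hD1 i)
  have hin : ∀ i (x y : EuclideanSpace ℝ (Fin (dv i))), ‖x‖ ≤ 1 → ‖y‖ ≤ 1 → |⟪x, y⟫| ≤ 1 := by
    intro i x y hx hy
    refine (abs_real_inner_le_norm x y).trans ?_
    exact mul_le_one₀ hx (norm_nonneg _) hy
  have hD2 : ∀ i, D i ≤ 2 := by
    intro i
    obtain ⟨l, hl⟩ := hD i
    have := (abs_le.1 (hin i _ _ (ha l i) (ha l₀ i))).1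
    linarith
  obtain ⟨s, r, u, hr, hu, hfy, hf0⟩ := exists_dual_normal_form hdv f
  have hle : ∀ l i, r i * (1 - ⟪u i, a l i⟫) ≤ s := by
    intro l i
    have h0 := hfa l
    rw [hfy] at h0
    have := Finset.single_le_sum (f := fun i => r i * (1 - ⟪u i, a l i⟫))
      (fun i _ => mul_nonneg (hr i) (by
        have := (abs_le.1 (hin i _ _ (hu i).le (ha l i))).2
        linarith)) (Finset.mem_univ i)
    linarith
  have hrD : ∀ i, r i * D i ≤ s := by
    intro i
    obtain ⟨l, hl⟩ := hD i
    have h6 := one_sub_inner_le_six_mul (ha l i) (ha l₀ i) (hu i) (le_max_left _ _)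
      (le_max_right _ _)
    have : D i ≤ max (1 - ⟪u i, a l i⟫) (1 - ⟪u i, a l₀ i⟫) := by linarith
    refine (mul_le_mul_of_nonneg_left this (hr i)).trans ?_
    rcases max_choice (1 - ⟪u i, a l i⟫) (1 - ⟪u i, a l₀ i⟫) with h | h <;> rw [h]
    exacts [hle l i, hle l₀ i]
  have hs : 0 < s := by
    have hs0 : 0 ≤ s := (mul_nonneg (hr ⟨0, hm⟩) (hD0 _)).trans (hrD _)
    refine hs0.lt_of_ne' fun h0 => hf (hf0 h0 fun i => ?_)
    have := hrD i
    rw [h0] at this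
    exact le_antisymm (nonpos_of_mul_nonpos_left this (hD0' i)) (hr i)
  refine (le_uniformDist_cap_product hm hu hD0' hD2).trans (measureReal_mono fun y hy => ?_)
  rw [Set.mem_ofPred_eq] at hy ⊢
  have hm' : (0 : ℝ) < m := by exact_mod_cast hm
  have : ∑ i, r i * (1 - ⟪u i, y i⟫) ≤ ∑ i : Fin m, s / (2 * m) := by
    refine Finset.sum_le_sum fun i _ => ?_
    rw [real_inner_comm]
    calc _ ≤ r i * (D i / (2 * m)) := mul_le_mul_of_nonneg_left (hy i) (hr i)
      _ = r i * D i / (2 * m) := by ring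
      _ ≤ _ := by gcongr; exact hrD i
  rw [Finset.sum_const, Finset.card_univ, Fintype.card_fin, nsmul_eq_mul] at this
  have h2 : (m : ℝ) * (s / (2 * m)) = s / 2 := by field_simp
  rw [hfy]
  linarith

end ProductOfBalls

end

section ProductTail

theorem exists_dyadic_level {y : ℝ} (hy : y ≤ 1) (N : ℕ) :
    ∃ l ≤ N, y ≤ (1 / 2) ^ l ∧ (l < N → (1 / 2) ^ (l + 1) ≤ y) := by
  classical
  let l := Nat.findGreatest (fun l => y ≤ (1 / 2) ^ l) N
  refine ⟨l, Nat.findGreatest_le N, ?_, fun hl => ?_⟩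
  · exact Nat.findGreatest_spec (P := fun l => y ≤ (1 / 2) ^ l) (Nat.zero_le N) (by simpa using hy)
  · have := Nat.findGreatest_is_greatest (P := fun l => y ≤ (1 / 2) ^ l) (Nat.lt_succ_self l) hl
    exact (not_le.1 this).le

variable {ι : Type*} [Fintype ι] [DecidableEq ι]

omit [DecidableEq ι] in
theorem exists_dyadic_levels [Nonempty ι] {y : ι → ℝ} (hy1 : ∀ i, y i ≤ 1) {N : ℕ}
    (hN : ∏ i, y i ≤ (1 / 2) ^ N) :
    ∃ l : ι → ℕ, (∀ i, l i ≤ N) ∧ (∀ i, y i ≤ (1 / 2) ^ l i) ∧ N ≤ ∑ i, l i + Fintype.card ι := by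
  choose l hlN hyl hly using fun i => exists_dyadic_level (hy1 i) N
  refine ⟨l, hlN, hyl, ?_⟩
  by_cases h : ∃ i, l i = N
  · obtain ⟨i, hi⟩ := h
    have := Finset.single_le_sum (f := l) (fun _ _ => Nat.zero_le _) (Finset.mem_univ i)
    omega
  · push Not at h
    have h1 : ∏ i, (1 / 2 : ℝ) ^ (l i + 1) ≤ ∏ i, y i :=
      Finset.prod_le_prod (fun i _ => by positivity) fun i _ => hly i ((hlN i).lt_of_ne (h i))
    rw [Finset.prod_pow_eq_pow_sum, Finset.sum_add_distrib] at h1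
    have h2 := h1.trans hN
    rw [pow_le_pow_iff_right_of_lt_one₀ (by norm_num) (by norm_num)] at h2
    simpa using h2

/-- The bound for the sum over all dyadic cells. -/
theorem sum_dyadic_le {a₀ : ℝ} {a : ι → ℝ} (ha : ∀ i, a₀ ≤ a i) {i₀ : ι} (hi₀ : a i₀ = a₀)
    (N : ℕ) :
    ∑ l ∈ Fintype.piFinset (fun i => if i = i₀ then {0} else Finset.range (N + 1)),
        ∏ i, (2 : ℝ) ^ (-((a i - a₀) * l i)) ≤
      (∏ i, (1 + (1 - (2 : ℝ) ^ (-(a i - a₀)))⁻¹)) *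
        (N + 1 : ℝ) ^ ((Finset.univ.filter fun i => a i = a₀).card - 1) := by
  rw [← Finset.prod_univ_sum (fun i => if i = i₀ then {0} else Finset.range (N + 1))
    (fun i j => (2 : ℝ) ^ (-((a i - a₀) * j)))]
  have hcard : (Finset.univ.filter fun i => a i = a₀).card - 1 =
      ((Finset.univ.filter fun i => a i = a₀).erase i₀).card := by
    rw [Finset.card_erase_of_mem (by simp [hi₀])]
  have hpow : (N + 1 : ℝ) ^ ((Finset.univ.filter fun i => a i = a₀).card - 1) =
      ∏ i, if i ∈ (Finset.univ.filter fun i => a i = a₀).erase i₀ then (N + 1 : ℝ) else 1 := by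
    rw [hcard, Finset.prod_ite_mem, Finset.univ_inter, Finset.prod_const]
  have hx : ∀ i, 0 < (2 : ℝ) ^ (-(a i - a₀)) ∧ (2 : ℝ) ^ (-(a i - a₀)) ≤ 1 := fun i =>
    ⟨by positivity, Real.rpow_le_one_of_one_le_of_nonpos (by norm_num) (by linarith [ha i])⟩
  have hK : ∀ i, 1 ≤ 1 + (1 - (2 : ℝ) ^ (-(a i - a₀)))⁻¹ := fun i => by
    have : 0 ≤ (1 - (2 : ℝ) ^ (-(a i - a₀)))⁻¹ := inv_nonneg.2 (by linarith [(hx i).2])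
    linarith
  rw [hpow, ← Finset.prod_mul_distrib]
  refine Finset.prod_le_prod (fun i _ => Finset.sum_nonneg fun j _ => by positivity) fun i _ => ?_
  by_cases h0 : i = i₀
  · simpa [h0] using hK i₀
  by_cases h1 : a i = a₀
  · simp only [h0, h1, if_false, Finset.mem_erase, ne_eq, not_false_eq_true, Finset.mem_filter,
      Finset.mem_univ, true_and, if_true, sub_self, zero_mul, neg_zero, Real.rpow_zero]
    simp
  · have hlt : (2 : ℝ) ^ (-(a i - a₀)) < 1 :=
      Real.rpow_lt_one_of_one_lt_of_neg (by norm_num) (by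
        have := (ha i).lt_of_ne' h1; linarith)
    simp only [h0, h1, if_false, Finset.mem_erase, ne_eq, Finset.mem_filter,
      Finset.mem_univ, and_false, mul_one]
    have h2 : ∀ j : ℕ, (2 : ℝ) ^ (-((a i - a₀) * j)) = ((2 : ℝ) ^ (-(a i - a₀))) ^ j := fun j => by
      rw [← Real.rpow_natCast, ← Real.rpow_mul (by norm_num)]; congr 1; ring
    simp only [h2]
    have := (summable_geometric_of_lt_one (hx i).1.le hlt).sum_le_tsum (Finset.range (N + 1))
      fun j _ => pow_nonneg (hx i).1.le j
    rw [tsum_geometric_of_lt_one (hx i).1.le hlt] at this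
    linarith

theorem measureReal_prod_le {Ω : Type*} [MeasurableSpace Ω] (P : Measure Ω) [IsProbabilityMeasure P]
    {Y : ι → Ω → ℝ} (hY1 : ∀ i ω, Y i ω ≤ 1) {a₀ C₀ : ℝ} (ha₀ : 0 ≤ a₀) (hC₀ : 0 ≤ C₀)
    {a : ι → ℝ} (ha : ∀ i, a₀ ≤ a i) {i₀ : ι} (hi₀ : a i₀ = a₀)
    (hbox : ∀ l : ι → ℕ, P.real {ω | ∀ i, Y i ω ≤ (1 / 2) ^ l i} ≤
      C₀ * ∏ i, (2 : ℝ) ^ (-(a i * l i))) (N : ℕ) :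
    P.real {ω | ∏ i, Y i ω ≤ (1 / 2) ^ N} ≤
      C₀ * (2 : ℝ) ^ (a₀ * Fintype.card ι) * (∏ i, (1 + (1 - (2 : ℝ) ^ (-(a i - a₀)))⁻¹)) *
        (2 : ℝ) ^ (-(a₀ * N)) *
        (N + 1 : ℝ) ^ ((Finset.univ.filter fun i => a i = a₀).card - 1) := by
  have : Nonempty ι := ⟨i₀⟩
  let T := Fintype.piFinset (fun i : ι => if i = i₀ then {0} else Finset.range (N + 1))
  let t : (ι → ℕ) → ℕ := fun l => N - (Fintype.card ι + ∑ i, l i)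
  let l' : (ι → ℕ) → ι → ℕ := fun l i => l i + if i = i₀ then t l else 0
  have hsub : {ω | ∏ i, Y i ω ≤ (1 / 2) ^ N} ⊆
      ⋃ l ∈ T, {ω | ∀ i, Y i ω ≤ (1 / 2) ^ l' l i} := by
    intro ω hω
    obtain ⟨l, hlN, hly, hls⟩ := exists_dyadic_levels (fun i => hY1 i ω) hω
    let k : ι → ℕ := fun i => if i = i₀ then 0 else l i
    have hk : k ∈ T := by
      rw [Fintype.mem_piFinset]
      intro i
      by_cases hi : i = i₀
      · simp [k, hi]
      · simpa [k, hi] using Nat.lt_succ_of_le (hlN i)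
    refine Set.mem_iUnion₂.2 ⟨k, hk, fun i => ?_⟩
    by_cases hi : i = i₀
    · have hsum : ∑ i, l i = ∑ i, k i + l i₀ := by
        have : ∀ i, l i = k i + if i = i₀ then l i₀ else 0 := by
          intro i; by_cases h : i = i₀ <;> simp [k, h]
        rw [Finset.sum_congr rfl fun i _ => this i, Finset.sum_add_distrib]
        simp
      have hle : l' k i ≤ l i := by
        subst hi
        simp only [l', t, k, if_true] at hsum ⊢
        omega
      exact (hly i).trans (pow_le_pow_of_le_one (by norm_num) (by norm_num) hle)
    · simpa [l', k, hi] using hly i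
  calc P.real {ω | ∏ i, Y i ω ≤ (1 / 2) ^ N}
      ≤ ∑ l ∈ T, P.real {ω | ∀ i, Y i ω ≤ (1 / 2) ^ l' l i} :=
        (measureReal_mono hsub (measure_ne_top _ _)).trans (measureReal_biUnion_finset_le _ _)
    _ ≤ ∑ l ∈ T, C₀ * ((2 : ℝ) ^ (a₀ * Fintype.card ι) * (2 : ℝ) ^ (-(a₀ * N)) *
          ∏ i, (2 : ℝ) ^ (-((a i - a₀) * l i))) := by
        refine Finset.sum_le_sum fun l _ => (hbox _).trans (mul_le_mul_of_nonneg_left ?_ hC₀)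
        rw [← Real.rpow_sum_of_pos (by norm_num), ← Real.rpow_sum_of_pos (by norm_num),
          ← Real.rpow_add (by norm_num), ← Real.rpow_add (by norm_num)]
        refine Real.rpow_le_rpow_of_exponent_le (by norm_num) ?_
        have h1 : ∑ i, -(a i * (l' l i : ℕ)) = -(∑ i, a i * l i) - a₀ * t l := by
          simp only [l', Nat.cast_add, mul_add, neg_add, Finset.sum_add_distrib,
            Finset.sum_neg_distrib]
          simp [hi₀, sub_eq_add_neg]
        have h2 : ∑ i, -((a i - a₀) * (l i : ℝ)) = -(∑ i, a i * l i) + a₀ * ∑ i, (l i : ℝ) := by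
          rw [Finset.mul_sum, ← Finset.sum_neg_distrib, ← Finset.sum_add_distrib]
          exact Finset.sum_congr rfl fun i _ => by ring
        have h3 : (N : ℝ) ≤ t l + (Fintype.card ι + ∑ i, (l i : ℝ)) := by
          have : N ≤ t l + (Fintype.card ι + ∑ i, l i) := by simp only [t]; omega
          exact_mod_cast this
        rw [h1, h2]
        nlinarith
    _ = C₀ * ((2 : ℝ) ^ (a₀ * Fintype.card ι) * (2 : ℝ) ^ (-(a₀ * N)) *
          ∑ l ∈ T, ∏ i, (2 : ℝ) ^ (-((a i - a₀) * l i))) := by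
        rw [← Finset.mul_sum, ← Finset.mul_sum]
    _ ≤ C₀ * ((2 : ℝ) ^ (a₀ * Fintype.card ι) * (2 : ℝ) ^ (-(a₀ * N)) *
          ((∏ i, (1 + (1 - (2 : ℝ) ^ (-(a i - a₀)))⁻¹)) *
        (N + 1 : ℝ) ^ ((Finset.univ.filter fun i => a i = a₀).card - 1))) := by
        gcongr
        exact sum_dyadic_le ha hi₀ N
    _ = _ := by ring

end ProductTail

section LaplaceTail

theorem exists_sum_exp_le {c : ℝ} (hc : 0 < c) (a : ℝ) :
    ∃ B : ℝ, 0 ≤ B ∧ ∀ L : ℕ, ∑ k ∈ Finset.range (L + 1),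
      Real.exp (c / 2 - c * 2 ^ k / 2) * (2 : ℝ) ^ (a * k) ≤ B := by
  obtain ⟨b, hb⟩ := exists_nat_ge (a + 1)
  let K := Real.exp (c / 2) * (b.factorial * (2 / c) ^ b)
  refine ⟨K * 2, by positivity, fun L => ?_⟩
  have hterm : ∀ k : ℕ, Real.exp (c / 2 - c * 2 ^ k / 2) * (2 : ℝ) ^ (a * k) ≤
      K * (1 / 2) ^ k := by
    intro k
    have h1 : (c * 2 ^ k / 2) ^ b / b.factorial ≤ Real.exp (c * 2 ^ k / 2) :=
      Real.pow_div_factorial_le_exp _ (by positivity) b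
    have h2 : Real.exp (-(c * 2 ^ k / 2)) ≤ b.factorial * (2 / c) ^ b * (2 : ℝ) ^ (-(b * k : ℝ)) := by
      rw [Real.exp_neg]
      refine (inv_anti₀ (by positivity) h1).trans_eq ?_
      rw [Real.rpow_neg (by norm_num), ← Nat.cast_mul, Real.rpow_natCast,
        show c * 2 ^ k / 2 = (2 / c)⁻¹ * 2 ^ k by field_simp, mul_pow, ← pow_mul, mul_comm k b,
        inv_pow]
      field_simp
    rw [sub_eq_add_neg, Real.exp_add]
    calc _ ≤ Real.exp (c / 2) * (b.factorial * (2 / c) ^ b * (2 : ℝ) ^ (-(b * k : ℝ))) *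
          (2 : ℝ) ^ (a * k) := by gcongr
      _ = K * (2 : ℝ) ^ (-(b * k : ℝ) + a * k) := by
          rw [Real.rpow_add (by norm_num)]; simp only [K]; ring
      _ ≤ K * (2 : ℝ) ^ (-(k : ℝ)) := by
          gcongr
          · norm_num
          · have : (0 : ℝ) ≤ k := Nat.cast_nonneg k
            nlinarith
      _ = _ := by rw [Real.rpow_neg (by norm_num), Real.rpow_natCast]; simp
  calc _ ≤ ∑ k ∈ Finset.range (L + 1), K * (1 / 2) ^ k := Finset.sum_le_sum fun k _ => hterm k
    _ = K * ∑ k ∈ Finset.range (L + 1), (1 / 2) ^ k := by rw [Finset.mul_sum]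
    _ ≤ K * 2 := by
        gcongr
        have := (summable_geometric_two).sum_le_tsum (Finset.range (L + 1))
          fun j _ => by positivity
        rwa [tsum_geometric_two] at this

theorem exp_neg_le_sum_dyadic {c : ℝ} (hc : 0 < c) {L M : ℕ} (hM : 2 ^ L ≤ M) {q : ℝ}
    (hq0 : 0 ≤ q) (hq1 : q ≤ 1) :
    ∃ N ∈ Finset.range (L + 1), q ≤ (1 / 2) ^ N ∧
      Real.exp (-(M * (c * q))) ≤ Real.exp (c / 2 - c * 2 ^ (L - N) / 2) := by
  obtain ⟨N, hN, h1, h2⟩ := exists_dyadic_level hq1 L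
  refine ⟨N, Finset.mem_range.2 (Nat.lt_succ_of_le hN), h1, Real.exp_le_exp.2 ?_⟩
  have hM' : (2 : ℝ) ^ L ≤ M := by exact_mod_cast hM
  rcases hN.lt_or_eq with hN | rfl
  · have h3 := h2 hN
    have h4 : (2 : ℝ) ^ (L - N) / 2 ≤ M * q := by
      calc (2 : ℝ) ^ (L - N) / 2 = 2 ^ L * (1 / 2) ^ (N + 1) := by
            obtain ⟨k, rfl⟩ := Nat.exists_eq_add_of_lt hN
            have : N + k + 1 - N = k + 1 := by omega
            rw [this, one_div, inv_pow]
            field_simp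
            ring
        _ ≤ _ := by gcongr
    nlinarith
  · have : 0 ≤ M * (c * q) := by positivity
    simp
    linarith

theorem lintegral_exp_neg_le {c : ℝ} (hc : 0 < c) {a C₁ B : ℝ} (ha : 0 ≤ a) (hC₁ : 0 ≤ C₁)
    (hBL : ∀ L : ℕ, ∑ k ∈ Finset.range (L + 1),
      Real.exp (c / 2 - c * 2 ^ k / 2) * (2 : ℝ) ^ (a * k) ≤ B) {p : ℕ}
    {Ω : Type*} [MeasurableSpace Ω] (P : Measure Ω) [IsProbabilityMeasure P]
    {Q : Ω → ℝ} (hQm : Measurable Q) (hQ0 : ∀ ω, 0 ≤ Q ω) (hQ1 : ∀ ω, Q ω ≤ 1)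
    (hQ : ∀ N : ℕ, P.real {ω | Q ω ≤ (1 / 2) ^ N} ≤
      C₁ * (2 : ℝ) ^ (-(a * N)) * (N + 1 : ℝ) ^ p) {M : ℕ} (hM : M ≠ 0) :
    ∫⁻ ω, ENNReal.ofReal (2 * Real.exp (-(M * (c * Q ω)))) ∂P ≤
      ENNReal.ofReal (2 * C₁ * B * (2 / M) ^ a * (Nat.log 2 M + 1 : ℝ) ^ p) := by
  let L := Nat.log 2 M
  let w : ℕ → ℝ := fun k => Real.exp (c / 2 - c * 2 ^ k / 2)
  let S : ℕ → Set Ω := fun N => {ω | Q ω ≤ (1 / 2) ^ N}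
  have hS : ∀ N, MeasurableSet (S N) := fun N => measurableSet_le hQm measurable_const
  have hw : ∀ k, 0 ≤ w k := fun k => (Real.exp_pos _).le
  calc ∫⁻ ω, ENNReal.ofReal (2 * Real.exp (-(M * (c * Q ω)))) ∂P
      ≤ ∫⁻ ω, ∑ N ∈ Finset.range (L + 1),
          (S N).indicator (fun _ => ENNReal.ofReal (2 * w (L - N))) ω ∂P := by
        refine lintegral_mono fun ω => ?_
        obtain ⟨N, hN, h1, h2⟩ := exp_neg_le_sum_dyadic hc (Nat.pow_log_le_self 2 hM)
          (hQ0 ω) (hQ1 ω)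
        refine le_trans ?_ (Finset.single_le_sum (fun _ _ => zero_le) hN)
        rw [Set.indicator_of_mem (show ω ∈ S N from h1)]
        exact ENNReal.ofReal_le_ofReal (by simp only [w, L]; linarith)
    _ = ∑ N ∈ Finset.range (L + 1), ENNReal.ofReal (2 * w (L - N)) * P (S N) := by
        rw [lintegral_finsetSum _ fun N _ => (measurable_const.indicator (hS N))]
        exact Finset.sum_congr rfl fun N _ => lintegral_indicator_const (hS N) _
    _ ≤ ∑ N ∈ Finset.range (L + 1), ENNReal.ofReal
          (2 * C₁ * (2 : ℝ) ^ (-(a * L)) * (L + 1 : ℝ) ^ p *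
            (w (L - N) * (2 : ℝ) ^ (a * (L - N : ℕ)))) := by
        refine Finset.sum_le_sum fun N hN => ?_
        have hNL : N ≤ L := Nat.lt_succ_iff.1 (Finset.mem_range.1 hN)
        rw [← ENNReal.ofReal_toReal (measure_ne_top P (S N)),
          ← ENNReal.ofReal_mul (mul_nonneg zero_le_two (hw _))]
        refine ENNReal.ofReal_le_ofReal ?_
        have h1 : (2 : ℝ) ^ (-(a * N)) = (2 : ℝ) ^ (-(a * L)) * (2 : ℝ) ^ (a * (L - N : ℕ)) := by
          rw [← Real.rpow_add (by norm_num), Nat.cast_sub hNL]; congr 1; ring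
        calc _ ≤ 2 * w (L - N) * (C₁ * (2 : ℝ) ^ (-(a * N)) * (L + 1 : ℝ) ^ p) := by
              refine mul_le_mul_of_nonneg_left ((hQ N).trans ?_) (mul_nonneg zero_le_two (hw _))
              gcongr
          _ = _ := by rw [h1]; ring
    _ = ENNReal.ofReal (2 * C₁ * (2 : ℝ) ^ (-(a * L)) * (L + 1 : ℝ) ^ p *
          ∑ k ∈ Finset.range (L + 1), w k * (2 : ℝ) ^ (a * k)) := by
        rw [← ENNReal.ofReal_sum_of_nonneg fun N _ => by
          have := hw (L - N); positivity, ← Finset.mul_sum]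
        congr 2
        have := Finset.sum_range_reflect (fun k : ℕ => w k * (2 : ℝ) ^ (a * k)) (L + 1)
        simpa using this
    _ ≤ ENNReal.ofReal (2 * C₁ * B * (2 / M) ^ a * (Nat.log 2 M + 1 : ℝ) ^ p) := by
        refine ENNReal.ofReal_le_ofReal ?_
        have hM0 : (0 : ℝ) < M := by exact_mod_cast Nat.pos_of_ne_zero hM
        have h1 : (2 : ℝ) ^ (-(a * L)) ≤ (2 / M) ^ a := by
          have : (2 : ℝ) ^ (-(a * L)) = ((1 / 2) ^ L) ^ a := by
            rw [one_div, inv_pow, ← Real.rpow_natCast, ← Real.rpow_neg (by norm_num),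
              ← Real.rpow_mul (by norm_num)]
            congr 1; ring
          rw [this]
          refine Real.rpow_le_rpow (by positivity) ?_ ha
          have h2 : (M : ℝ) < 2 ^ (L + 1) := by
            exact_mod_cast Nat.lt_pow_succ_log_self (by norm_num) M
          rw [one_div, inv_pow, inv_eq_one_div, div_le_div_iff₀ (by positivity) hM0]
          rw [pow_succ] at h2
          linarith
        calc _ ≤ 2 * C₁ * (2 / M) ^ a * (L + 1 : ℝ) ^ p * B := by
              gcongr
              exact hBL L
          _ = _ := by ring

end LaplaceTail

section

open scoped InnerProductSpace RealInnerProductSpace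

theorem ballDist_shell_le {k : ℕ} (hk : 1 ≤ k) {τ : ℝ} (hτ : 0 < τ) :
    ballDist k {y | 1 - ⟪y, y⟫ ≤ τ} ≤ ENNReal.ofReal (k * τ) := by
  have hk' : (1 : ℝ) ≤ k := by exact_mod_cast hk
  rcases le_or_gt 1 τ with h1 | h1
  · refine prob_le_one.trans ?_
    rw [ENNReal.one_le_ofReal]
    nlinarith
  · have hsub : {y : EuclideanSpace ℝ (Fin k) | 1 - ⟪y, y⟫ ≤ τ} ⊆
        (Metric.closedBall 0 (1 - τ))ᶜ := by
      intro y hy hy'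
      rw [Set.mem_ofPred_eq, real_inner_self_eq_norm_sq] at hy
      rw [mem_closedBall_zero_iff] at hy'
      nlinarith [norm_nonneg y]
    refine (measure_mono hsub).trans ?_
    rw [prob_compl_eq_one_sub Metric.isClosed_closedBall.measurableSet,
      ballDist_closedBall (by linarith) (by linarith), ← ENNReal.ofReal_one,
      ← ENNReal.ofReal_sub _ (pow_nonneg (by linarith) _)]
    refine ENNReal.ofReal_le_ofReal ?_
    have := one_add_mul_le_pow (a := -τ) (by linarith) k
    rw [← sub_eq_add_neg] at this
    linarith

section ProductOfBalls

variable {m : ℕ} {dv : Fin m → ℕ}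

theorem uniformDist_pi_le {S : Π i, Set (EuclideanSpace ℝ (Fin (dv i)))} {c : Fin m → ℝ}
    (hc : ∀ i, 0 ≤ c i) (h : ∀ i, ballDist (dv i) (S i) ≤ ENNReal.ofReal (c i)) :
    uniformDist (prodOfBalls dv) {y | ∀ i, y i ∈ S i} ≤ ENNReal.ofReal (∏ i, c i) := by
  have h1 : {y : Π i, EuclideanSpace ℝ (Fin (dv i)) | ∀ i, y i ∈ S i} = Set.univ.pi S := by
    ext; simp
  rw [uniformDist_prodOfBalls, h1, Measure.pi_pi, ENNReal.ofReal_prod_of_nonneg fun i _ => hc i]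
  exact Finset.prod_le_prod' fun i _ => h i

theorem uniformDist_cap_product_le {v : Π i, EuclideanSpace ℝ (Fin (dv i))} (hv : ∀ i, ‖v i‖ ≤ 1)
    {τ : Fin m → ℝ} (hτ : ∀ i, 0 < τ i) :
    uniformDist (prodOfBalls dv) {y | ∀ i, 1 - ⟪y i, v i⟫ ≤ τ i} ≤
      ENNReal.ofReal (∏ i, 2 ^ dv i * τ i ^ (((dv i : ℝ) + 1) / 2)) :=
  uniformDist_pi_le (fun i => by have := hτ i; positivity) fun i => ballDist_cap_le (hv i) (hτ i)

theorem pi_uniformDist_box_le (hdv : ∀ i, 1 ≤ dv i) {κ : Type*} [Fintype κ] [DecidableEq κ]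
    (l₀ : κ) {τ : Fin m → ℝ} (hτ : ∀ i, 0 < τ i) :
    (Measure.pi fun _ : κ => uniformDist (prodOfBalls dv))
        {a | ∀ l i, 1 - ⟪a l i, a l₀ i⟫ ≤ τ i} ≤
      ENNReal.ofReal ((∏ i, dv i * τ i) *
        (∏ i, 2 ^ dv i * τ i ^ (((dv i : ℝ) + 1) / 2)) ^ (Fintype.card κ - 1)) := by
  let μ := uniformDist (prodOfBalls dv)
  have hS : MeasurableSet {a : κ → Π i, EuclideanSpace ℝ (Fin (dv i)) |
      ∀ l i, 1 - ⟪a l i, a l₀ i⟫ ≤ τ i} := by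
    simp only [Set.ofPred_forall]
    refine MeasurableSet.iInter fun l => MeasurableSet.iInter fun i => ?_
    exact (isClosed_le (by fun_prop) continuous_const).measurableSet
  rw [measure_pi_eq_lintegral_glue _ (· = l₀) hS]
  let e : {l // l = l₀} := ⟨l₀, rfl⟩
  let W : Set (Π i, EuclideanSpace ℝ (Fin (dv i))) := {v | ∀ i, 1 - ⟪v i, v i⟫ ≤ τ i}
  have hW : MeasurableSet W := by
    simp only [W, Set.ofPred_forall]
    refine MeasurableSet.iInter fun i => ?_
    exact (isClosed_le (by fun_prop) continuous_const).measurableSet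
  let A : Set ({l // l = l₀} → Π i, EuclideanSpace ℝ (Fin (dv i))) := Function.eval e ⁻¹' W
  have hA : MeasurableSet A := measurable_pi_apply e hW
  have hAm : (Measure.pi fun _ : {l // l = l₀} => μ) A ≤ ENNReal.ofReal (∏ i, dv i * τ i) := by
    rw [(measurePreserving_eval (fun _ : {l // l = l₀} => μ) e).measure_preimage
      hW.nullMeasurableSet]
    exact uniformDist_pi_le (S := fun i => {y | 1 - ⟪y, y⟫ ≤ τ i})
      (fun i => mul_nonneg (Nat.cast_nonneg _) (hτ i).le) fun i => ballDist_shell_le (hdv i) (hτ i)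
  let K := ENNReal.ofReal ((∏ i, 2 ^ dv i * τ i ^ (((dv i : ℝ) + 1) / 2)) ^ (Fintype.card κ - 1))
  have hprod : 0 ≤ ∏ i, 2 ^ dv i * τ i ^ (((dv i : ℝ) + 1) / 2) :=
    Finset.prod_nonneg fun i _ => by have := hτ i; positivity
  calc _ ≤ ∫⁻ a, A.indicator (fun _ => K) a ∂(Measure.pi fun _ : {l // l = l₀} => μ) := by
        refine lintegral_mono_ae ?_
        filter_upwards [ae_pi_norm_le_one_uniformDist dv {l // l = l₀}] with a ha
        by_cases haA : a ∈ A
        · rw [Set.indicator_of_mem haA]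
          have hsub : {b : {l // ¬ l = l₀} → Π i, EuclideanSpace ℝ (Fin (dv i)) |
              glue (· = l₀) a b ∈ {a : κ → Π i, EuclideanSpace ℝ (Fin (dv i)) |
                ∀ l i, 1 - ⟪a l i, a l₀ i⟫ ≤ τ i}} ⊆
              Set.univ.pi fun _ => {y | ∀ i, 1 - ⟪y i, a e i⟫ ≤ τ i} := by
            intro b hb l _ i
            simpa [glue, l.2] using hb l i
          refine (measure_mono hsub).trans ?_
          rw [Measure.pi_pi, Finset.prod_const, Finset.card_univ, Fintype.card_subtype_compl,
            Fintype.card_subtype_eq]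
          simp only [K]
          rw [ENNReal.ofReal_pow hprod]
          exact pow_le_pow_left' (uniformDist_cap_product_le (ha e) hτ) _
        · rw [Set.indicator_of_notMem haA]
          refine le_of_eq (measure_mono_null (t := ∅) ?_ measure_empty)
          intro b hb
          exact haA fun i => by simpa [glue] using hb l₀ i
    _ = K * (Measure.pi fun _ : {l // l = l₀} => μ) A := lintegral_indicator_const hA _
    _ ≤ K * ENNReal.ofReal (∏ i, dv i * τ i) := by gcongr
    _ = _ := by
        rw [mul_comm, ENNReal.ofReal_mul (Finset.prod_nonneg fun i _ =>
          mul_nonneg (Nat.cast_nonneg _) (hτ i).le)]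

end ProductOfBalls

end

section

open scoped InnerProductSpace RealInnerProductSpace

section Spread

variable {m : ℕ} {dv : Fin m → ℕ} {κ : Type*} [Fintype κ]

/-- The size, in the `i`-th coordinate, of the smallest cap of `Z` that contains the family `a`,
measured from the base point `a l₀` and truncated to `[0, 1]`. -/
def spread (l₀ : κ) (i : Fin m) (a : κ → Π i, EuclideanSpace ℝ (Fin (dv i))) : ℝ :=
  max 0 (min 1 ((Finset.univ.sup' ⟨l₀, Finset.mem_univ l₀⟩ fun l => 1 - ⟪a l i, a l₀ i⟫) / 6))

theorem spread_nonneg (l₀ : κ) (i : Fin m) (a : κ → Π i, EuclideanSpace ℝ (Fin (dv i))) :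
    0 ≤ spread l₀ i a := le_max_left _ _

theorem spread_le_one (l₀ : κ) (i : Fin m) (a : κ → Π i, EuclideanSpace ℝ (Fin (dv i))) :
    spread l₀ i a ≤ 1 := max_le zero_le_one (min_le_left _ _)

theorem measurable_spread (l₀ : κ) (i : Fin m) :
    Measurable (spread (dv := dv) l₀ i) := by
  refine measurable_const.max (measurable_const.min (Measurable.div_const ?_ 6))
  have : Measurable (Finset.univ.sup' ⟨l₀, Finset.mem_univ l₀⟩
      fun l (a : κ → Π i, EuclideanSpace ℝ (Fin (dv i))) => 1 - ⟪a l i, a l₀ i⟫) :=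
    Finset.measurable_sup' _ fun l _ => Continuous.measurable (by fun_prop)
  convert this using 1
  ext a
  exact (Finset.apply_sup'_eq_sup'_comp (f := fun l (a : κ → Π i, EuclideanSpace ℝ (Fin (dv i))) =>
    1 - ⟪a l i, a l₀ i⟫) _ (fun g => g a) (fun _ _ => rfl)).symm

theorem six_mul_spread {a : κ → Π i, EuclideanSpace ℝ (Fin (dv i))} (ha : ∀ l i, ‖a l i‖ ≤ 1)
    (l₀ : κ) (i : Fin m) :
    6 * spread l₀ i a =
      Finset.univ.sup' ⟨l₀, Finset.mem_univ l₀⟩ fun l => 1 - ⟪a l i, a l₀ i⟫ := by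
  have h := fun l => abs_le.1 ((abs_real_inner_le_norm (a l i) (a l₀ i)).trans
    (mul_le_one₀ (ha l i) (norm_nonneg _) (ha l₀ i)))
  have h0 : 0 ≤ Finset.univ.sup' ⟨l₀, Finset.mem_univ l₀⟩ fun l => 1 - ⟪a l i, a l₀ i⟫ :=
    (sub_nonneg.2 (h l₀).2).trans
      (Finset.le_sup' (fun l => 1 - ⟪a l i, a l₀ i⟫) (Finset.mem_univ l₀))
  have h2 : (Finset.univ.sup' ⟨l₀, Finset.mem_univ l₀⟩ fun l => 1 - ⟪a l i, a l₀ i⟫) ≤ 2 :=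
    Finset.sup'_le _ _ fun l _ => by linarith [(h l).1]
  rw [spread, min_eq_right (by linarith), max_eq_right (by linarith)]
  ring

theorem exists_six_mul_spread_le {a : κ → Π i, EuclideanSpace ℝ (Fin (dv i))}
    (ha : ∀ l i, ‖a l i‖ ≤ 1) (l₀ : κ) (i : Fin m) :
    ∃ l, 6 * spread l₀ i a ≤ 1 - ⟪a l i, a l₀ i⟫ := by
  obtain ⟨l, -, hl⟩ := Finset.exists_mem_eq_sup' ⟨l₀, Finset.mem_univ l₀⟩
    fun l => 1 - ⟪a l i, a l₀ i⟫
  exact ⟨l, by rw [six_mul_spread ha, hl]⟩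

theorem le_six_mul_spread {a : κ → Π i, EuclideanSpace ℝ (Fin (dv i))}
    (ha : ∀ l i, ‖a l i‖ ≤ 1) (l₀ l : κ) (i : Fin m) :
    1 - ⟪a l i, a l₀ i⟫ ≤ 6 * spread l₀ i a := by
  rw [six_mul_spread ha]
  exact Finset.le_sup' (fun l => 1 - ⟪a l i, a l₀ i⟫) (Finset.mem_univ l)

theorem pi_spread_box_le [DecidableEq κ] (hdv : ∀ i, 1 ≤ dv i) (l₀ : κ) (l : Fin m → ℕ) :
    (Measure.pi fun _ : κ => uniformDist (prodOfBalls dv)).real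
        {a | ∀ i, spread l₀ i a ^ (((dv i : ℝ) + 1) / 2) ≤ (1 / 2) ^ l i} ≤
      (∏ i, dv i * 6 * (2 ^ dv i * (6 : ℝ) ^ (((dv i : ℝ) + 1) / 2)) ^ (Fintype.card κ - 1)) *
        ∏ i, (2 : ℝ) ^ (-((2 / ((dv i : ℝ) + 1) + (Fintype.card κ - 1 : ℕ)) * l i)) := by
  let x : Fin m → ℝ := fun i => (1 / 2) ^ l i
  have hx : ∀ i, 0 < x i := fun i => by positivity
  let τ : Fin m → ℝ := fun i => 6 * x i ^ (2 / ((dv i : ℝ) + 1))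
  have hτ : ∀ i, 0 < τ i := fun i => by have := hx i; positivity
  have h1 : (Measure.pi fun _ : κ => uniformDist (prodOfBalls dv))
      {a | ∀ i, spread l₀ i a ^ (((dv i : ℝ) + 1) / 2) ≤ (1 / 2) ^ l i} ≤
      (Measure.pi fun _ : κ => uniformDist (prodOfBalls dv))
        {a | ∀ l i, 1 - ⟪a l i, a l₀ i⟫ ≤ τ i} := by
    refine measure_mono_ae ?_
    filter_upwards [ae_pi_norm_le_one_uniformDist dv κ] with a ha hs k i
    refine (le_six_mul_spread ha l₀ k i).trans (mul_le_mul_of_nonneg_left ?_ (by norm_num))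
    have h2 := Real.rpow_le_rpow (Real.rpow_nonneg (spread_nonneg l₀ i a) _) (hs i)
      (by positivity : 0 ≤ 2 / ((dv i : ℝ) + 1))
    rw [← Real.rpow_mul (spread_nonneg l₀ i a)] at h2
    have h3 : ((dv i : ℝ) + 1) / 2 * (2 / ((dv i : ℝ) + 1)) = 1 := by field_simp
    rwa [h3, Real.rpow_one] at h2
  have h2 := h1.trans (pi_uniformDist_box_le hdv l₀ hτ)
  rw [measureReal_def]
  refine (ENNReal.toReal_le_of_le_ofReal ?_ h2).trans_eq ?_
  · exact mul_nonneg (Finset.prod_nonneg fun i _ => mul_nonneg (Nat.cast_nonneg _) (hτ i).le)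
      (pow_nonneg (Finset.prod_nonneg fun i _ => by have := hτ i; positivity) _)
  rw [← Finset.prod_pow, ← Finset.prod_mul_distrib, ← Finset.prod_mul_distrib]
  refine Finset.prod_congr rfl fun i _ => ?_
  have h3 : τ i ^ (((dv i : ℝ) + 1) / 2) = (6 : ℝ) ^ (((dv i : ℝ) + 1) / 2) * x i := by
    simp only [τ]
    rw [Real.mul_rpow (by norm_num) (Real.rpow_nonneg (hx i).le _), ← Real.rpow_mul (hx i).le]
    have h3 : (2 / ((dv i : ℝ) + 1)) * (((dv i : ℝ) + 1) / 2) = 1 := by field_simp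
    rw [h3, Real.rpow_one]
  have h4 : (2 : ℝ) ^ (-((2 / ((dv i : ℝ) + 1) + (Fintype.card κ - 1 : ℕ)) * l i)) =
      x i ^ (2 / ((dv i : ℝ) + 1)) * x i ^ (Fintype.card κ - 1) := by
    have : x i = (2 : ℝ) ^ (-(l i : ℝ)) := by
      simp only [x]
      rw [one_div, inv_pow, Real.rpow_neg (by norm_num), Real.rpow_natCast]
    rw [← Real.rpow_natCast, ← Real.rpow_add (hx i), this, ← Real.rpow_mul (by norm_num)]
    congr 1; ring
  rw [h3, h4]
  simp only [τ]
  ring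

end Spread

end

section

open Module

section UpperBound

variable {m : ℕ} {dv : Fin m → ℕ}

theorem exists_measureReal_supports_le (hm : 1 ≤ m) (hdv : ∀ i, 1 ≤ dv i) {dmax : ℕ}
    (hdmax : IsGreatest (Set.range dv) dmax) :
    ∃ C : ℝ, 0 ≤ C ∧ ∀ n : ℕ, ∑ i, dv i < n → ∀ J : Finset (Fin n), J.card = ∑ i, dv i →
      (Measure.pi fun _ : Fin n => uniformDist (prodOfBalls dv)).real {x | Supports x J} ≤
        C * (2 / (n - ∑ i, dv i : ℕ) : ℝ) ^ (2 / ((dmax : ℝ) + 1) + (∑ i, dv i - 1 : ℕ)) *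
          (Nat.log 2 (n - ∑ i, dv i) + 1 : ℝ) ^
            ((Finset.univ.filter fun i => dv i = dmax).card - 1) := by
  obtain ⟨⟨i₀, hi₀⟩, hmax⟩ := hdmax
  have hmax' : ∀ i, dv i ≤ dmax := fun i => hmax ⟨i, rfl⟩
  let d := ∑ i, dv i
  have hd : 1 ≤ d := (hdv i₀).trans (Finset.single_le_sum (fun _ _ => Nat.zero_le _)
    (Finset.mem_univ i₀))
  let c : ℝ := ∏ i, (1 / 4) ^ dv i * (1 / (2 * m) : ℝ) ^ (((dv i : ℝ) + 1) / 2)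
  have hm' : (0 : ℝ) < m := by exact_mod_cast hm
  have hc : 0 < c := Finset.prod_pos fun i _ => by positivity
  let a : Fin m → ℝ := fun i => 2 / ((dv i : ℝ) + 1) + (d - 1 : ℕ)
  let a₀ : ℝ := 2 / ((dmax : ℝ) + 1) + (d - 1 : ℕ)
  have ha₀ : 0 ≤ a₀ := by positivity
  have haa : ∀ i, a₀ ≤ a i := fun i => by
    have : (dv i : ℝ) ≤ dmax := by exact_mod_cast hmax' i
    simp only [a, a₀]
    gcongr
  have hai : ∀ i, a i = a₀ ↔ dv i = dmax := fun i => by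
    simp only [a, a₀, add_left_inj]
    rw [div_eq_div_iff (by positivity) (by positivity)]
    constructor
    · intro h
      have : (dv i : ℝ) = dmax := by linarith
      exact_mod_cast this
    · intro h; rw [h]
  obtain ⟨B, hB0, hB⟩ := exists_sum_exp_le hc a₀
  let C₀ : ℝ := ∏ i, dv i * 6 * (2 ^ dv i * (6 : ℝ) ^ (((dv i : ℝ) + 1) / 2)) ^ (d - 1)
  have hC₀ : 0 ≤ C₀ := Finset.prod_nonneg fun i _ => by positivity
  let C₁ : ℝ := C₀ * (2 : ℝ) ^ (a₀ * Fintype.card (Fin m)) *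
    ∏ i, (1 + (1 - (2 : ℝ) ^ (-(a i - a₀)))⁻¹)
  have hC₁ : 0 ≤ C₁ := by
    refine mul_nonneg (by positivity) (Finset.prod_nonneg fun i _ => ?_)
    have : (2 : ℝ) ^ (-(a i - a₀)) ≤ 1 :=
      Real.rpow_le_one_of_one_le_of_nonpos one_le_two (by linarith [haa i])
    have := inv_nonneg.2 (sub_nonneg.2 this)
    linarith
  refine ⟨2 * C₁ * B, by positivity, fun n hn J hJ => ?_⟩
  have hcard : Fintype.card {i // i ∈ J} = d := by rw [Fintype.card_coe, hJ]
  have hne : Nonempty {i // i ∈ J} := Fintype.card_pos_iff.1 (by omega)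
  obtain ⟨l₀⟩ := hne
  let P := Measure.pi fun _ : {i // i ∈ J} => uniformDist (prodOfBalls dv)
  let Y : Fin m → ({i // i ∈ J} → Π i, EuclideanSpace ℝ (Fin (dv i))) → ℝ :=
    fun i ω => spread l₀ i ω ^ (((dv i : ℝ) + 1) / 2)
  have hY0 : ∀ i ω, 0 ≤ Y i ω := fun i ω => Real.rpow_nonneg (spread_nonneg _ _ _) _
  have hY1 : ∀ i ω, Y i ω ≤ 1 := fun i ω =>
    Real.rpow_le_one (spread_nonneg _ _ _) (spread_le_one _ _ _) (by positivity)
  have hbox : ∀ l : Fin m → ℕ, P.real {ω | ∀ i, Y i ω ≤ (1 / 2) ^ l i} ≤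
      C₀ * ∏ i, (2 : ℝ) ^ (-(a i * l i)) := fun l => by
    have := pi_spread_box_le hdv l₀ l
    rwa [hcard] at this
  have hN := measureReal_prod_le P hY1 ha₀ hC₀ haa ((hai i₀).2 hi₀) hbox
  have hM : n - d ≠ 0 := by omega
  have key := lintegral_exp_neg_le hc ha₀ hC₁ hB P (Q := fun ω => ∏ i, Y i ω)
    (Finset.measurable_prod _ fun i _ => (measurable_spread l₀ i).pow_const _)
    (fun ω => Finset.prod_nonneg fun i _ => hY0 i ω)
    (fun ω => Finset.prod_le_one (fun i _ => hY0 i ω) fun i _ => hY1 i ω) hN hM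
  have hsup := pi_supports_le_lintegral (μ := uniformDist (prodOfBalls dv)) (J := J)
    (Q := fun ω => c * ∏ i, Y i ω)
    (uniformDist_prodOfBalls_affineSubspace dv) (hJ.trans (finrank_prodSpace dv).symm) (by
      filter_upwards [ae_pi_norm_le_one_uniformDist dv {i // i ∈ J}] with ω hω f hf hfa
      exact le_uniformDist_halfspace hm hdv hω l₀ (fun i => spread_nonneg l₀ i ω)
        (exists_six_mul_spread_le hω l₀) hf hfa)
  rw [finrank_prodSpace, Fintype.card_fin] at hsup
  have hfin := hsup.trans key
  have hcongr : (Finset.univ.filter fun i => a i = a₀) =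
      Finset.univ.filter fun i => dv i = dmax := Finset.filter_congr fun i _ => hai i
  rw [hcongr] at hfin
  rw [measureReal_def]
  exact ENNReal.toReal_le_of_le_ofReal (by positivity) hfin

end UpperBound

end

section UpperBoundAsymptotic

theorem natLog_add_one_le {n k : ℕ} (hn : 3 ≤ n) (hk : k ≤ n) :
    (Nat.log 2 k + 1 : ℝ) ≤ 3 * Real.log n := by
  have h1 : (Nat.log 2 k : ℝ) ≤ Nat.log 2 n := by exact_mod_cast Nat.log_mono_right hk
  have h2 : (Nat.log 2 n : ℝ) * Real.log 2 ≤ Real.log n := by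
    rw [← Real.log_pow]
    refine Real.log_le_log (by positivity) ?_
    exact_mod_cast Nat.pow_log_le_self 2 (by omega)
  have h3 := Real.log_two_gt_d9
  have h4 : (1 : ℝ) ≤ Real.log n := by
    rw [Real.le_log_iff_exp_le (by positivity)]
    have : (3 : ℝ) ≤ n := by exact_mod_cast hn
    linarith [Real.exp_one_lt_d9]
  nlinarith [Nat.cast_nonneg (α := ℝ) (Nat.log 2 n)]

variable {m : ℕ} {dv : Fin m → ℕ}

theorem expectedFaceCountUniform_eq {n j : ℕ} (hn : ∑ i, dv i + 1 ≤ n) (hj : j < ∑ i, dv i) :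
    expectedFaceCountUniform dv j n = ∑ I ∈ Finset.univ.powersetCard (j + 1),
      (Measure.pi fun _ : Fin n => uniformDist (prodOfBalls dv)).real {x | Supports x I} :=
  integral_faceCount_eq (uniformDist_prodOfBalls_affineSubspace dv)
    (by rwa [finrank_prodSpace, Fintype.card_fin]) (by rwa [finrank_prodSpace])

theorem exists_expectedFaceCountUniform_le (hm : 1 ≤ m) (hdv : ∀ i, 1 ≤ dv i) {dmax : ℕ}
    (hdmax : IsGreatest (Set.range dv) dmax) :
    ∃ C : ℝ, ∀ᶠ n : ℕ in atTop, ∀ j < ∑ i, dv i, expectedFaceCountUniform dv j n ≤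
      C * ((n : ℝ) ^ (((dmax : ℝ) - 1) / ((dmax : ℝ) + 1)) *
        Real.log n ^ ((Finset.univ.filter fun i => dv i = dmax).card - 1)) := by
  obtain ⟨C, hC0, hC⟩ := exists_measureReal_supports_le hm hdv hdmax
  set d := ∑ i, dv i with hd
  set p := (Finset.univ.filter fun i => dv i = dmax).card - 1
  set a : ℝ := 2 / ((dmax : ℝ) + 1) + (d - 1 : ℕ) with ha
  have ha0 : 0 ≤ a := by positivity
  refine ⟨2 ^ d * (C * 4 ^ a * 3 ^ p), ?_⟩
  filter_upwards [eventually_ge_atTop (2 * d + 3)] with n hn j hj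
  have hn0 : (0 : ℝ) < n := by exact_mod_cast (by omega : 0 < n)
  let P := (Measure.pi fun _ : Fin n => uniformDist (prodOfBalls dv))
  have hb : (2 / (n - d : ℕ) : ℝ) ^ a ≤ 4 ^ a * (n : ℝ) ^ (-a) := by
    rw [Real.rpow_neg hn0.le, ← div_eq_mul_inv, ← Real.div_rpow (by norm_num) hn0.le]
    refine Real.rpow_le_rpow (by positivity) ?_ ha0
    have h1 : (0 : ℝ) < (n - d : ℕ) := by exact_mod_cast (by omega : 0 < n - d)
    rw [div_le_div_iff₀ h1 hn0]
    have : (n : ℝ) ≤ 2 * (n - d : ℕ) := by exact_mod_cast (by omega : n ≤ 2 * (n - d))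
    linarith
  have hJ : ∀ J ∈ Finset.univ.powersetCard d, P.real {x | Supports x J} ≤
      C * (4 ^ a * (n : ℝ) ^ (-a)) * (3 * Real.log n) ^ p := fun J hJ => by
    refine (hC n (by omega) J (Finset.mem_powersetCard.1 hJ).2).trans ?_
    gcongr
    exact natLog_add_one_le (by omega) (Nat.sub_le _ _)
  have hlog : 0 ≤ Real.log n := Real.log_natCast_nonneg n
  rw [expectedFaceCountUniform_eq (by omega) hj]
  refine (sum_measureReal_supports_le P (c' := d) (by rw [finrank_prodSpace, Fintype.card_fin]; omega)
    (by omega) (finrank_prodSpace dv).ge).trans ?_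
  have hs := Finset.sum_le_card_nsmul _ _ _ hJ
  rw [Finset.card_powersetCard, Finset.card_univ, Fintype.card_fin, nsmul_eq_mul] at hs
  have h2 : (d.choose (j + 1) : ℝ) ≤ 2 ^ d := by exact_mod_cast Nat.choose_le_two_pow _ _
  have h3 : (n.choose d : ℝ) ≤ (n : ℝ) ^ d := by exact_mod_cast Nat.choose_le_pow _ _
  have h4 : (n : ℝ) ^ d * (n : ℝ) ^ (-a) = (n : ℝ) ^ (((dmax : ℝ) - 1) / ((dmax : ℝ) + 1)) := by
    rw [← Real.rpow_natCast, ← Real.rpow_add hn0]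
    congr 1
    rw [ha, Nat.cast_sub (by omega)]
    have : (dmax : ℝ) + 1 ≠ 0 := by positivity
    field_simp
    push_cast
    ring
  calc _ ≤ 2 ^ d * ((n : ℝ) ^ d * (C * (4 ^ a * (n : ℝ) ^ (-a)) * (3 * Real.log n) ^ p)) := by
        refine mul_le_mul h2 (hs.trans ?_) (Finset.sum_nonneg fun _ _ => measureReal_nonneg)
          (by positivity)
        exact mul_le_mul_of_nonneg_right h3 (by positivity)
    _ = _ := by
        rw [← h4, mul_pow]
        ring

end UpperBoundAsymptotic

section

open Module
open scoped InnerProductSpace RealInnerProductSpace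

section VertexRegion

variable {m : ℕ} {dv : Fin m → ℕ}

theorem supports_singleton_of_cap {ι : Type*}
    {x : ι → Π i, EuclideanSpace ℝ (Fin (dv i))} {k₀ k₁ : ι} (hk : k₁ ≠ k₀)
    (hp : ∀ i, ‖x k₀ i‖ < 1) (hx : ∀ k, k ≠ k₀ → (∀ i, ‖x k i‖ ≤ 1) ∧
      ∃ i, m * (1 - ‖x k₀ i‖ ^ 2) < 1 - ⟪x k i, x k₀ i⟫) :
    Supports x {k₀} := by
  have hH : ∀ i, 0 < 1 - ‖x k₀ i‖ ^ 2 := fun i => by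
    have := hp i; have := norm_nonneg (x k₀ i); nlinarith
  let f : Dual ℝ ((Π i, EuclideanSpace ℝ (Fin (dv i))) × ℝ) :=
    ∑ i, (1 - ‖x k₀ i‖ ^ 2)⁻¹ • (LinearMap.snd ℝ _ ℝ -
      (innerₛₗ ℝ (x k₀ i)).comp ((LinearMap.proj i).comp (LinearMap.fst ℝ _ ℝ))) -
      (m : ℝ) • LinearMap.snd ℝ _ ℝ
  have hf : ∀ y, f (y, 1) = ∑ i, (1 - ‖x k₀ i‖ ^ 2)⁻¹ * (1 - ⟪y i, x k₀ i⟫) - m := fun y => by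
    simp [f, real_inner_comm]
  have h0 : f (x k₀, 1) = 0 := by
    rw [hf]
    simp_rw [real_inner_self_eq_norm_sq]
    rw [Finset.sum_congr rfl fun i _ => inv_mul_cancel₀ (hH i).ne']
    simp
  have hpos : ∀ k, k ≠ k₀ → 0 < f (x k, 1) := fun k hk => by
    obtain ⟨h1, i, hi⟩ := hx k hk
    have hnn : ∀ j ∈ Finset.univ, 0 ≤ (1 - ‖x k₀ j‖ ^ 2)⁻¹ * (1 - ⟪x k j, x k₀ j⟫) := fun j _ =>
      mul_nonneg (inv_nonneg.2 (hH j).le) (sub_nonneg.2 ((real_inner_le_norm _ _).trans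
        (mul_le_one₀ (h1 j) (norm_nonneg _) (hp j).le)))
    have h2 := Finset.single_le_sum hnn (Finset.mem_univ i)
    have h3 : (m : ℝ) < (1 - ‖x k₀ i‖ ^ 2)⁻¹ * (1 - ⟪x k i, x k₀ i⟫) := by
      rw [inv_mul_eq_div, lt_div_iff₀ (hH i)]; exact hi
    rw [hf]
    linarith
  refine ⟨f, fun h => ?_, fun k => ?_, fun k hk => ?_⟩
  · have := hpos k₁ hk
    rw [h] at this
    simp at this
  · rcases eq_or_ne k k₀ with rfl | hk
    · exact h0.ge
    · exact (hpos k hk).le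
  · rw [Finset.mem_singleton.1 hk, h0]

/-- Interior points of `Z` that are cut off, together with a box, by a cap that is so small that
`n` uniform points miss it with probability at least one half. -/
def vertexRegion (dv : Fin m → ℕ) (n : ℕ) : Set (Π i, EuclideanSpace ℝ (Fin (dv i))) :=
  {p | (∀ i, ‖p i‖ < 1) ∧
    n * ∏ i, (2 ^ dv i * (2 * m * (1 - ‖p i‖)) ^ (((dv i : ℝ) + 1) / 2)) ≤ 1 / 2}

theorem measurableSet_vertexRegion (dv : Fin m → ℕ) (n : ℕ) :
    MeasurableSet (vertexRegion dv n) := by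
  have h : Measurable fun p : Π i, EuclideanSpace ℝ (Fin (dv i)) =>
      (n : ℝ) * ∏ i, (2 ^ dv i * (2 * m * (1 - ‖p i‖)) ^ (((dv i : ℝ) + 1) / 2)) := by
    refine Measurable.const_mul (Finset.measurable_prod _ fun i _ => Measurable.const_mul
      (Measurable.pow_const ?_ _) _) _
    exact Continuous.measurable (by fun_prop)
  have h1 : MeasurableSet {p : Π i, EuclideanSpace ℝ (Fin (dv i)) | ∀ i, ‖p i‖ < 1} := by
    rw [Set.ofPred_forall]
    exact MeasurableSet.iInter fun i => measurableSet_lt (Continuous.measurable (by fun_prop))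
      measurable_const
  exact h1.inter (measurableSet_le h measurable_const)

theorem mul_uniformDist_cap_le (hm : 1 ≤ m) {n : ℕ} {p : Π i, EuclideanSpace ℝ (Fin (dv i))}
    (hp : p ∈ vertexRegion dv n) :
    n * uniformDist (prodOfBalls dv) {y | ∀ i, 1 - ⟪y i, p i⟫ ≤ m * (1 - ‖p i‖ ^ 2)} ≤ 1 / 2 := by
  have hm' : (0 : ℝ) < m := by exact_mod_cast hm
  have hH : ∀ i, 0 < 1 - ‖p i‖ ^ 2 ∧ 1 - ‖p i‖ ^ 2 ≤ 2 * (1 - ‖p i‖) := fun i => by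
    have := hp.1 i; have := norm_nonneg (p i); constructor <;> nlinarith
  have h1 := uniformDist_cap_product_le (fun i => (hp.1 i).le) fun i => mul_pos hm' (hH i).1
  have h2 : ∏ i, (2 : ℝ) ^ dv i * (m * (1 - ‖p i‖ ^ 2)) ^ (((dv i : ℝ) + 1) / 2) ≤
      ∏ i, (2 ^ dv i * (2 * m * (1 - ‖p i‖)) ^ (((dv i : ℝ) + 1) / 2)) := by
    refine Finset.prod_le_prod (fun i _ => ?_) fun i _ => ?_
    · have := (hH i).1; positivity
    · refine mul_le_mul_of_nonneg_left (Real.rpow_le_rpow ?_ ?_ (by positivity)) (by positivity)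
      · have := (hH i).1; positivity
      · nlinarith [(hH i).2]
  calc n * uniformDist (prodOfBalls dv) {y | ∀ i, 1 - ⟪y i, p i⟫ ≤ m * (1 - ‖p i‖ ^ 2)}
      ≤ ENNReal.ofReal n * ENNReal.ofReal
        (∏ i, (2 ^ dv i * (2 * m * (1 - ‖p i‖)) ^ (((dv i : ℝ) + 1) / 2))) := by
        rw [ENNReal.ofReal_natCast]
        gcongr
        exact h1.trans (ENNReal.ofReal_le_ofReal h2)
    _ ≤ ENNReal.ofReal (1 / 2) := by
        rw [← ENNReal.ofReal_mul (Nat.cast_nonneg _)]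
        exact ENNReal.ofReal_le_ofReal hp.2
    _ = 1 / 2 := by
        rw [ENNReal.ofReal_div_of_pos two_pos]; simp

theorem half_mul_vertexRegion_le (hm : 1 ≤ m) {n : ℕ} (hn : 2 ≤ n) (k₀ : Fin n) :
    1 / 2 * (uniformDist (prodOfBalls dv)).real (vertexRegion dv n) ≤
      (Measure.pi fun _ : Fin n => uniformDist (prodOfBalls dv)).real {x | Supports x {k₀}} := by
  let μ := uniformDist (prodOfBalls dv)
  obtain ⟨k₁, hk₁⟩ : ∃ k₁ : Fin n, k₁ ≠ k₀ := by
    have : Nontrivial (Fin n) := Fin.nontrivial_iff_two_le.2 hn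
    exact exists_ne k₀
  let e : {k : Fin n // k = k₀} := ⟨k₀, rfl⟩
  have key : ∀ a : {k : Fin n // k = k₀} → Π i, EuclideanSpace ℝ (Fin (dv i)),
      a e ∈ vertexRegion dv n → (1 / 2 : ENNReal) ≤
        (Measure.pi fun _ : {k : Fin n // ¬ k = k₀} => μ)
          {b | glue (· = k₀) a b ∈ {x | Supports x {k₀}}} := by
    intro a ha
    let A := {y : Π i, EuclideanSpace ℝ (Fin (dv i)) |
      ∀ i, 1 - ⟪y i, a e i⟫ ≤ m * (1 - ‖a e i‖ ^ 2)}
    set S := {b | glue (· = k₀) a b ∈ {x | Supports x {k₀}}} with hS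
    have h1 : (Measure.pi fun _ : {k : Fin n // ¬ k = k₀} => μ) Sᶜ ≤ 1 / 2 := by
      have hsub : (Measure.pi fun _ : {k : Fin n // ¬ k = k₀} => μ) Sᶜ ≤
          (Measure.pi fun _ : {k : Fin n // ¬ k = k₀} => μ) (⋃ k, Function.eval k ⁻¹' A) := by
        refine measure_mono_ae ?_
        filter_upwards [ae_pi_norm_le_one_uniformDist dv {k : Fin n // ¬ k = k₀}] with b hb hbS
        by_contra hcon
        refine hbS ?_
        have hcon' : ∀ k, ∃ i, m * (1 - ‖a e i‖ ^ 2) < 1 - ⟪b k i, a e i⟫ := by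
          intro k
          by_contra h
          push Not at h
          exact hcon (Set.mem_iUnion.2 ⟨k, h⟩)
        have hg0 : glue (· = k₀) a b k₀ = a e := by simp [glue, e]
        refine supports_singleton_of_cap hk₁ (by rw [hg0]; exact ha.1) fun k hk => ?_
        have hgk : glue (· = k₀) a b k = b ⟨k, hk⟩ := by simp [glue, hk]
        rw [hg0, hgk]
        exact ⟨hb _, hcon' _⟩
      refine hsub.trans ((measure_iUnion_le _).trans ?_)
      rw [tsum_fintype]
      have h2 : ∀ k, (Measure.pi fun _ : {k : Fin n // ¬ k = k₀} => μ) (Function.eval k ⁻¹' A) =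
          μ A := fun k => by
        refine (measurePreserving_eval (fun _ : {k : Fin n // ¬ k = k₀} => μ) k).measure_preimage
          (MeasurableSet.nullMeasurableSet ?_)
        simp only [A]
        rw [Set.ofPred_forall]
        exact MeasurableSet.iInter fun i => measurableSet_le
          (Continuous.measurable (by fun_prop)) measurable_const
      rw [Finset.sum_congr rfl fun k _ => h2 k, Finset.sum_const, nsmul_eq_mul, Finset.card_univ]
      refine le_trans ?_ (mul_uniformDist_cap_le hm ha)
      refine mul_le_mul_left ?_ (μ A)
      have := Fintype.card_subtype_le fun k : Fin n => ¬ k = k₀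
      rw [Fintype.card_fin] at this
      exact_mod_cast this
    have h2 := measure_univ_le_add_compl (μ := Measure.pi fun _ : {k : Fin n // ¬ k = k₀} => μ) S
    rw [measure_univ] at h2
    have h3 : (1 : ENNReal) - 1 / 2 ≤
        (Measure.pi fun _ : {k : Fin n // ¬ k = k₀} => μ) S :=
      tsub_le_iff_right.2 (h2.trans (by gcongr))
    simpa using h3
  have hmeas := measurableSet_vertexRegion dv n
  have hfin : (1 / 2 : ENNReal) * μ (vertexRegion dv n) ≤
      (Measure.pi fun _ : Fin n => μ) {x | Supports x {k₀}} := by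
    rw [measure_pi_eq_lintegral_glue μ (· = k₀) (isClosed_supports {k₀}).measurableSet,
      ← (measurePreserving_eval (fun _ : {k : Fin n // k = k₀} => μ) e).measure_preimage
        hmeas.nullMeasurableSet,
      ← lintegral_indicator_const ((measurable_pi_apply e) hmeas)]
    refine lintegral_mono fun a => ?_
    by_cases ha : a e ∈ vertexRegion dv n
    · rw [Set.indicator_of_mem (by exact ha)]
      exact key a ha
    · rw [Set.indicator_of_notMem (by exact ha)]
      exact zero_le
  have := ENNReal.toReal_mono (measure_ne_top _ _) hfin
  rw [ENNReal.toReal_mul] at this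
  simpa [measureReal_def] using this

end VertexRegion

end

section VertexRegionMeasure

theorem pow_div_factorial_le_card_finsuppAntidiag {ι : Type*} [DecidableEq ι] {s : Finset ι}
    (hs : s.Nonempty) (N : ℕ) :
    (N + 1 : ℝ) ^ (s.card - 1) / (s.card - 1).factorial ≤ (s.finsuppAntidiag N).card := by
  have hp := hs.card_pos
  rw [Finset.card_finsuppAntidiag_nat_eq_choose]
  have h1 : s.card + N - 1 = (s.card - 1) + N := by omega
  rw [h1, Nat.choose_symm_add.symm]
  refine le_trans (le_of_eq ?_) (Nat.pow_le_choose (α := ℝ) _ _)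
  have : s.card - 1 + N + 1 - (s.card - 1) = N + 1 := by omega
  rw [this]
  push_cast
  rfl

/-- The shell at depth between `ρ⁻¹ * t` and `t` inside the unit ball. -/
def ballShell (k : ℕ) (ρ t : ℝ) : Set (EuclideanSpace ℝ (Fin k)) :=
  {y | ‖y‖ ≤ 1 - t / ρ} \ {y | ‖y‖ ≤ 1 - t}

theorem measurableSet_ballShell (k : ℕ) (ρ t : ℝ) : MeasurableSet (ballShell k ρ t) :=
  (measurableSet_le measurable_norm measurable_const).diff
    (measurableSet_le measurable_norm measurable_const)

theorem half_le_ballDist_ballShell {k : ℕ} (hk : 1 ≤ k) {ρ t : ℝ} (hρ : 2 * k ≤ ρ) (ht : 0 ≤ t)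
    (ht1 : t ≤ 1) : t / 2 ≤ (ballDist k).real (ballShell k ρ t) := by
  have hk' : (1 : ℝ) ≤ k := by exact_mod_cast hk
  have hρ0 : 0 < ρ := by linarith
  have hle : t / ρ ≤ t := div_le_self ht (by linarith)
  have hsub : {y : EuclideanSpace ℝ (Fin k) | ‖y‖ ≤ 1 - t} ⊆ {y | ‖y‖ ≤ 1 - t / ρ} :=
    fun y (hy : ‖y‖ ≤ 1 - t) => show ‖y‖ ≤ 1 - t / ρ by linarith
  rw [ballShell, measureReal_sdiff hsub
    (measurableSet_le measurable_norm measurable_const), ballDist_norm_le (by linarith)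
      (by linarith [div_nonneg ht hρ0.le]), ballDist_norm_le (by linarith) (by linarith)]
  have h1 : (1 - t) ^ k ≤ 1 - t := pow_le_of_le_one (by linarith) (by linarith) (by omega)
  have h2 := one_add_mul_sub_le_pow (a := 1 - t / ρ) (by linarith) k
  have h3 : k * (t / ρ) ≤ t / 2 := by
    rw [mul_div_assoc', div_le_div_iff₀ hρ0 two_pos]
    nlinarith
  linarith

variable {m : ℕ} {dv : Fin m → ℕ}

theorem le_uniformDist_vertexRegion (hdv : ∀ i, 1 ≤ dv i) {ρ : ℝ} (hρ : ∀ i, 2 * dv i ≤ ρ)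
    (hρ1 : 1 < ρ) {dmax : ℕ} (hne : (Finset.univ.filter fun i => dv i = dmax).Nonempty) {n N : ℕ}
    (hN : n * (∏ i, (2 ^ dv i * (2 * m : ℝ) ^ (((dv i : ℝ) + 1) / 2))) *
      ρ ^ (-(((dmax : ℝ) + 1) / 2 * N)) ≤ 1 / 2) :
    (N + 1 : ℝ) ^ ((Finset.univ.filter fun i => dv i = dmax).card - 1) /
      ((Finset.univ.filter fun i => dv i = dmax).card - 1).factorial *
        ((1 / 2) ^ m * ρ⁻¹ ^ N) ≤
      (uniformDist (prodOfBalls dv)).real (vertexRegion dv n) := by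
  set s := Finset.univ.filter fun i => dv i = dmax with hs
  have hρ0 : 0 < ρ := by linarith
  let B : (Fin m →₀ ℕ) → Set (Π i, EuclideanSpace ℝ (Fin (dv i))) := fun l =>
    Set.univ.pi fun i => ballShell (dv i) ρ (ρ⁻¹ ^ l i)
  have hBm : ∀ l, MeasurableSet (B l) := fun l =>
    MeasurableSet.univ_pi fun i => measurableSet_ballShell _ _ _
  have hdisj : Pairwise fun l l' => Disjoint (B l) (B l') := by
    have aux : ∀ l l' : Fin m →₀ ℕ, ∀ i, l i < l' i → Disjoint (B l) (B l') := by
      intro l l' i hi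
      rw [Set.disjoint_left]
      intro y hy hy'
      have h1 : ‖y i‖ ≤ 1 - ρ⁻¹ ^ l i / ρ := (hy i trivial).1
      have h2 : ¬ ‖y i‖ ≤ 1 - ρ⁻¹ ^ l' i := (hy' i trivial).2
      refine h2 (h1.trans ?_)
      rw [div_eq_mul_inv, ← pow_succ]
      have : ρ⁻¹ ^ l' i ≤ ρ⁻¹ ^ (l i + 1) :=
        pow_le_pow_of_le_one (by positivity) (inv_le_one_of_one_le₀ hρ1.le) hi
      linarith
    intro l l' hll
    obtain ⟨i, hi⟩ := Finsupp.ne_iff.1 hll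
    rcases lt_or_gt_of_ne hi with h | h
    · exact aux l l' i h
    · exact (aux l' l i h).symm
  have hBsub : ∀ l ∈ s.finsuppAntidiag N, B l ⊆ vertexRegion dv n := by
    intro l hl y hy
    rw [Finset.mem_finsuppAntidiag] at hl
    have h1 : ∀ i, ‖y i‖ < 1 := fun i => by
      have := (hy i trivial).1
      have h2 : 0 < ρ⁻¹ ^ l i / ρ := by positivity
      have h3 : ‖y i‖ ≤ 1 - ρ⁻¹ ^ l i / ρ := this
      linarith
    refine ⟨h1, le_trans ?_ hN⟩
    rw [mul_assoc]
    refine mul_le_mul_of_nonneg_left ?_ (Nat.cast_nonneg _)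
    have h2 : ∏ i, (ρ⁻¹ ^ l i) ^ (((dv i : ℝ) + 1) / 2) = ρ ^ (-(((dmax : ℝ) + 1) / 2 * N)) := by
      have h3 : ∀ i, (ρ⁻¹ ^ l i) ^ (((dv i : ℝ) + 1) / 2) =
          ρ ^ (-(((dmax : ℝ) + 1) / 2 * l i)) := fun i => by
        by_cases hi : dv i = dmax
        · rw [hi, ← Real.rpow_natCast, ← Real.rpow_mul (by positivity), Real.inv_rpow hρ0.le,
            ← Real.rpow_neg hρ0.le, mul_comm]
        · have : l i = 0 := by
            by_contra h0
            exact hi (by simpa [hs] using hl.2 (Finsupp.mem_support_iff.2 h0))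
          simp [this]
      simp_rw [h3]
      rw [← Real.rpow_sum_of_pos hρ0, Finset.sum_neg_distrib, ← Finset.mul_sum]
      congr 3
      rw [← hl.1, Nat.cast_sum]
      symm
      refine Finset.sum_subset (Finset.subset_univ _) fun i _ hi => ?_
      have : l i = 0 := by
        by_contra h0
        exact hi (hl.2 (Finsupp.mem_support_iff.2 h0))
      simp [this]
    rw [← h2, ← Finset.prod_mul_distrib]
    refine Finset.prod_le_prod (fun i _ => ?_) fun i _ => ?_
    · have := h1 i
      have : 0 ≤ 1 - ‖y i‖ := by linarith
      positivity
    · have h3 : 0 ≤ 1 - ‖y i‖ := by linarith [h1 i]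
      rw [Real.mul_rpow (by positivity) h3, ← mul_assoc]
      refine mul_le_mul_of_nonneg_left (Real.rpow_le_rpow h3 ?_ (by positivity)) (by positivity)
      have h4 := (hy i trivial).2
      have h5 : ¬ ‖y i‖ ≤ 1 - ρ⁻¹ ^ l i := h4
      linarith
  have hBle : ∀ l ∈ s.finsuppAntidiag N, (1 / 2) ^ m * ρ⁻¹ ^ N ≤
      (uniformDist (prodOfBalls dv)).real (B l) := by
    intro l hl
    rw [Finset.mem_finsuppAntidiag] at hl
    rw [uniformDist_prodOfBalls, measureReal_def, Measure.pi_pi, ENNReal.toReal_prod]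
    have h1 : ((1 : ℝ) / 2) ^ m * ρ⁻¹ ^ N = ∏ i, (ρ⁻¹ ^ l i / 2) := by
      have hsum : ∑ i, l i = N := by
        rw [← hl.1]
        symm
        refine Finset.sum_subset (Finset.subset_univ _) fun i _ hi => ?_
        by_contra h0
        exact hi (hl.2 (Finsupp.mem_support_iff.2 h0))
      simp_rw [div_eq_mul_inv, Finset.prod_mul_distrib, Finset.prod_pow_eq_pow_sum, hsum]
      simp [mul_comm]
    rw [h1]
    refine Finset.prod_le_prod (fun i _ => by positivity) fun i _ => ?_
    exact half_le_ballDist_ballShell (hdv i) (hρ i) (by positivity)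
      (pow_le_one₀ (by positivity) (inv_le_one_of_one_le₀ hρ1.le))
  calc _ ≤ ((s.finsuppAntidiag N).card : ℝ) * ((1 / 2) ^ m * ρ⁻¹ ^ N) :=
        mul_le_mul_of_nonneg_right (pow_div_factorial_le_card_finsuppAntidiag hne N)
          (by positivity)
    _ ≤ ∑ l ∈ s.finsuppAntidiag N, (uniformDist (prodOfBalls dv)).real (B l) := by
        rw [← nsmul_eq_mul]
        exact Finset.card_nsmul_le_sum _ _ _ hBle
    _ = (uniformDist (prodOfBalls dv)).real (⋃ l ∈ s.finsuppAntidiag N, B l) :=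
        (measureReal_biUnion_finset (fun l _ l' _ h => hdisj h) fun l _ => hBm l).symm
    _ ≤ _ := measureReal_mono (Set.iUnion₂_subset hBsub) (measure_ne_top _ _)

end VertexRegionMeasure

section LowerBoundAsymptotic

variable {m : ℕ} {dv : Fin m → ℕ}

theorem half_mul_vertexRegion_le_expectedFaceCountUniform (hm : 1 ≤ m) {n j : ℕ}
    (hn : ∑ i, dv i + 1 ≤ n) (hj : j < ∑ i, dv i) :
    n * (1 / 2 * (uniformDist (prodOfBalls dv)).real (vertexRegion dv n)) ≤
      (j + 1) * expectedFaceCountUniform dv j n := by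
  rw [expectedFaceCountUniform_eq hn hj]
  have h := sum_measureReal_supports_le (Measure.pi fun _ : Fin n => uniformDist (prodOfBalls dv))
    (c := 1) (c' := j + 1) (by rw [finrank_prodSpace, Fintype.card_fin]; omega) (by omega)
    (by rw [finrank_prodSpace]; omega)
  rw [Nat.choose_one_right, Nat.cast_add, Nat.cast_one] at h
  refine le_trans ?_ h
  rw [Finset.powersetCard_one, Finset.sum_map]
  have h1 := Finset.card_nsmul_le_sum (Finset.univ : Finset (Fin n)) _ _
    fun k _ => half_mul_vertexRegion_le (dv := dv) hm (by omega : 2 ≤ n) k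
  rw [Finset.card_univ, Fintype.card_fin, nsmul_eq_mul] at h1
  exact h1

theorem exists_le_uniformDist_vertexRegion (hm : 1 ≤ m) (hdv : ∀ i, 1 ≤ dv i) {dmax : ℕ}
    (hdmax : IsGreatest (Set.range dv) dmax) :
    ∃ c : ℝ, 0 < c ∧ ∀ n : ℕ, 1 ≤ n →
      c * ((n : ℝ) ^ (-(2 / ((dmax : ℝ) + 1))) *
        Real.log n ^ ((Finset.univ.filter fun i => dv i = dmax).card - 1)) ≤
      (uniformDist (prodOfBalls dv)).real (vertexRegion dv n) := by
  obtain ⟨⟨i₀, hi₀⟩, hmax⟩ := hdmax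
  have hmax' : ∀ i, dv i ≤ dmax := fun i => hmax ⟨i, rfl⟩
  have hne : (Finset.univ.filter fun i => dv i = dmax).Nonempty := ⟨i₀, by simp [hi₀]⟩
  set p := (Finset.univ.filter fun i => dv i = dmax).card - 1
  have hdm : (1 : ℝ) ≤ dmax := by rw [← hi₀]; exact_mod_cast hdv i₀
  have hm' : (1 : ℝ) ≤ m := by exact_mod_cast hm
  let ρ : ℝ := 2 * dmax
  have hρ1 : 1 < ρ := by simp only [ρ]; linarith
  have hρ0 : 0 < ρ := by linarith
  let α : ℝ := ((dmax : ℝ) + 1) / 2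
  have hα : 0 < α := by positivity
  let K : ℝ := ∏ i, (2 ^ dv i * (2 * m : ℝ) ^ (((dv i : ℝ) + 1) / 2))
  have hK : 1 ≤ K := by
    refine Finset.prod_induction _ (1 ≤ ·) (fun _ _ => one_le_mul_of_one_le_of_one_le) le_rfl
      fun i _ => ?_
    exact one_le_mul_of_one_le_of_one_le (one_le_pow₀ one_le_two)
      (Real.one_le_rpow (by linarith) (by positivity))
  have hlρ : 0 < Real.log ρ := Real.log_pos hρ1
  let b : ℝ := α * Real.log ρ
  have hb : 0 < b := by positivity
  refine ⟨(1 / b) ^ p / p.factorial * ((1 / 2) ^ m * (ρ⁻¹ * (2 * K) ^ (-(1 / α)))), by positivity,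
    fun n hn => ?_⟩
  have hn1 : (1 : ℝ) ≤ n := by exact_mod_cast hn
  have hn0 : (0 : ℝ) < n := by linarith
  have hT : 1 ≤ 2 * n * K := by nlinarith
  have hT0 : 0 < 2 * n * K := by linarith
  have hlT : 0 ≤ Real.log (2 * n * K) := Real.log_nonneg hT
  let N := ⌈Real.log (2 * n * K) / b⌉₊
  have hN1 : Real.log (2 * n * K) ≤ b * N := by
    have := Nat.le_ceil (Real.log (2 * n * K) / b)
    rwa [div_le_iff₀' hb] at this
  have hN2 : (N : ℝ) ≤ Real.log (2 * n * K) / b + 1 := (Nat.ceil_lt_add_one (by positivity)).le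
  have hcond : n * K * ρ ^ (-(α * N)) ≤ 1 / 2 := by
    have h1 : 2 * n * K ≤ ρ ^ (α * N) := by
      rw [Real.rpow_def_of_pos hρ0, ← Real.log_le_iff_le_exp hT0]
      refine hN1.trans_eq ?_
      simp only [b]; ring
    rw [Real.rpow_neg hρ0.le, ← div_eq_mul_inv, div_le_iff₀ (by positivity)]
    linarith
  have hρN : ρ⁻¹ * ((2 * K) ^ (-(1 / α)) * (n : ℝ) ^ (-(2 / ((dmax : ℝ) + 1)))) ≤ ρ⁻¹ ^ N := by
    have h2 : (2 / ((dmax : ℝ) + 1)) = 1 / α := by simp only [α]; field_simp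
    rw [h2, ← Real.mul_rpow (by positivity) hn0.le, inv_pow, ← Real.rpow_natCast,
      ← Real.rpow_neg hρ0.le, ← Real.rpow_neg_one, Real.rpow_def_of_pos hρ0,
      Real.rpow_def_of_pos (by positivity), Real.rpow_def_of_pos hρ0, ← Real.exp_add]
    refine Real.exp_le_exp.2 ?_
    have h3 : 2 * K * n = 2 * n * K := by ring
    rw [h3]
    have h4 : Real.log (2 * n * K) * (1 / α) = Real.log ρ * (Real.log (2 * n * K) / b) := by
      simp only [b]; field_simp
    nlinarith [mul_le_mul_of_nonneg_left hN2 hlρ.le]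
  have hlogN : 1 / b * Real.log n ≤ N + 1 := by
    have h1 : Real.log n ≤ Real.log (2 * n * K) := Real.log_le_log hn0 (by nlinarith)
    rw [one_div_mul_eq_div, div_le_iff₀' hb]
    nlinarith
  refine le_trans ?_ (le_uniformDist_vertexRegion hdv (ρ := ρ) (fun i => ?_) hρ1 hne (N := N) hcond)
  · have hlog : 0 ≤ Real.log n := Real.log_nonneg hn1
    calc _ = (1 / b * Real.log n) ^ p / p.factorial * ((1 / 2) ^ m *
          (ρ⁻¹ * ((2 * K) ^ (-(1 / α)) * (n : ℝ) ^ (-(2 / ((dmax : ℝ) + 1)))))) := by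
          rw [mul_pow]; ring
      _ ≤ _ := by gcongr
  · have : (dv i : ℝ) ≤ dmax := by exact_mod_cast hmax' i
    simp only [ρ]; linarith

theorem exists_le_expectedFaceCountUniform (hm : 1 ≤ m) (hdv : ∀ i, 1 ≤ dv i) {dmax : ℕ}
    (hdmax : IsGreatest (Set.range dv) dmax) :
    ∃ c : ℝ, 0 < c ∧ ∀ᶠ n : ℕ in atTop, ∀ j < ∑ i, dv i,
      c * ((n : ℝ) ^ (((dmax : ℝ) - 1) / ((dmax : ℝ) + 1)) *
        Real.log n ^ ((Finset.univ.filter fun i => dv i = dmax).card - 1)) ≤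
      expectedFaceCountUniform dv j n := by
  obtain ⟨c, hc, h⟩ := exists_le_uniformDist_vertexRegion hm hdv hdmax
  obtain ⟨⟨i₀, hi₀⟩, -⟩ := hdmax
  have hd : 1 ≤ ∑ i, dv i := (hdv i₀).trans (Finset.single_le_sum (fun _ _ => Nat.zero_le _)
    (Finset.mem_univ i₀))
  set d := ∑ i, dv i
  have hd' : (0 : ℝ) < d := by exact_mod_cast hd
  refine ⟨c / (2 * d), by positivity, ?_⟩
  filter_upwards [eventually_ge_atTop (d + 1)] with n hn j hj
  have hn0 : (0 : ℝ) < n := by exact_mod_cast (by omega : 0 < n)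
  have h1 := half_mul_vertexRegion_le_expectedFaceCountUniform hm hn hj
  have h2 := h n (by omega)
  have hE : 0 ≤ expectedFaceCountUniform dv j n := integral_nonneg fun _ => Nat.cast_nonneg _
  have hjd : (j : ℝ) + 1 ≤ d := by exact_mod_cast hj
  have hpow : (n : ℝ) ^ (((dmax : ℝ) - 1) / ((dmax : ℝ) + 1)) =
      n * (n : ℝ) ^ (-(2 / ((dmax : ℝ) + 1))) := by
    nth_rewrite 2 [← Real.rpow_one (n : ℝ)]
    rw [← Real.rpow_add hn0]
    congr 1
    field_simp
    ring
  rw [hpow, div_mul_eq_mul_div, div_le_iff₀ (by positivity)]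
  have h3 := mul_le_mul_of_nonneg_left h2 hn0.le
  have h4 := mul_le_mul_of_nonneg_right hjd hE
  linarith

end LowerBoundAsymptotic

section RatioBounds

theorem le_liminf_and_limsup_le {u v : ℕ → ℝ} {c C : ℝ} (hv : ∀ᶠ n in atTop, 0 < v n)
    (hc : ∀ᶠ n in atTop, c * v n ≤ u n) (hC : ∀ᶠ n in atTop, u n ≤ C * v n) :
    c ≤ liminf (fun n => u n / v n) atTop ∧ limsup (fun n => u n / v n) atTop ≤ C := by
  have h1 : ∀ᶠ n in atTop, c ≤ u n / v n := by
    filter_upwards [hv, hc] with n h0 h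
    rwa [le_div_iff₀ h0]
  have h2 : ∀ᶠ n in atTop, u n / v n ≤ C := by
    filter_upwards [hv, hC] with n h0 h
    rwa [div_le_iff₀ h0]
  exact ⟨le_liminf_of_le (isBoundedUnder_of_eventually_le h2).isCoboundedUnder_ge h1,
    limsup_le_of_le (isBoundedUnder_of_eventually_ge h1).isCoboundedUnder_le h2⟩

end RatioBounds

/-- **Corollary 1.2 (B), face numbers**: in the uniform case, for every
`j ∈ {0, …, d−1}`, `E f_j(P_n) ≍ n^{(d_max−1)/(d_max+1)} (ln n)^{#d_max−1}`. -/
theorem expected_faces_uniform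
    (d m : ℕ) (hd : 2 ≤ d) (hm : 1 ≤ m) (hmd : m ≤ d)
    (dv : Fin m → ℕ) (hdv : ∀ i, 1 ≤ dv i) (hsum : ∑ i, dv i = d)
    (dmax : ℕ) (hdmax : IsGreatest (Set.range dv) dmax)
    (ndmax : ℕ) (hndmax : ndmax = (Finset.univ.filter fun i => dv i = dmax).card) :
    ∃ c C : ℝ, 0 < c ∧ c ≤ C ∧
      ∀ j : ℕ, j ≤ d - 1 →
        c ≤ liminf (fun n : ℕ => expectedFaceCountUniform dv j n /
              ((n : ℝ) ^ (((dmax : ℝ) - 1) / ((dmax : ℝ) + 1)) *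
                Real.log n ^ (ndmax - 1))) atTop ∧
        limsup (fun n : ℕ => expectedFaceCountUniform dv j n /
              ((n : ℝ) ^ (((dmax : ℝ) - 1) / ((dmax : ℝ) + 1)) *
                Real.log n ^ (ndmax - 1))) atTop ≤ C := by
  subst hndmax hsum
  obtain ⟨c, hc0, hc⟩ := exists_le_expectedFaceCountUniform hm hdv hdmax
  obtain ⟨C, hC⟩ := exists_expectedFaceCountUniform_le hm hdv hdmax
  have hv : ∀ᶠ n : ℕ in atTop, 0 < (n : ℝ) ^ (((dmax : ℝ) - 1) / ((dmax : ℝ) + 1)) *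
      Real.log n ^ ((Finset.univ.filter fun i => dv i = dmax).card - 1) := by
    filter_upwards [eventually_ge_atTop 2] with n hn
    have hn' : (1 : ℝ) < n := by exact_mod_cast hn
    have := Real.log_pos hn'
    positivity
  refine ⟨c, max c C, hc0, le_max_left _ _, fun j hj => ?_⟩
  have hj' : j < ∑ i, dv i := by omega
  refine le_liminf_and_limsup_le hv (hc.mono fun n h => h j hj') ?_
  filter_upwards [hC, hv] with n h h0
  exact (h j hj').trans (mul_le_mul_of_nonneg_right (le_max_right _ _) h0.le)
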